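/- arXiv:math/0501319 — 3 statements merged into one kernel-verified Lean document; each statement's English description precedes it below -/
import Mathlib

section
/- There exists ε₀ > 0, depending only on n, σ₀, A₀ and A₁, such that for every ε ∈ (0, ε₀) the following holds. Define z(t,x,ξ) = x(t,x,ξ) − x − 2t ξ(t,x,ξ) and ζ(t,x,ξ) = ξ(t,x,ξ) − ξ. For every integer k ≥ 0 there is M_k > 0 (depending only on k, n, σ₀ and the constants A_ℓ) such that for all multi-indices A, B ∈ ℕⁿ with |A| + |B| ≤ k, all t ≥ 0 (resp. t ≤ 0) and all (x,ξ) ∈ 𝒮₊ (resp. (x,ξ) ∈ 𝒮₋) with 1/2 ≤ |ξ| ≤ 2: |∂_x^A ∂_ξ^B z(t,x,ξ)| ≤ ε M_k ⟨x⟩^{−(|A|+σ₀)} and |∂_x^A ∂_ξ^B ζ(t,x,ξ)| ≤ ε M_k ⟨x⟩^{−(1+|A|+σ₀)}. -/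
open MeasureTheory Set
open scoped BigOperators

noncomputable section

namespace Paper

/-- `ℝⁿ` with the Euclidean norm. -/
abbrev Eu (n : ℕ) := EuclideanSpace ℝ (Fin n)

/-- The Japanese bracket `⟨x⟩ = (1 + |x|²)^{1/2}`. -/
def jb {n : ℕ} (x : Eu n) : ℝ := Real.sqrt (1 + ‖x‖ ^ 2)

/-- `⟨t⟩ = (1 + t²)^{1/2}` for a real number `t`. -/
def jbr (t : ℝ) : ℝ := Real.sqrt (1 + t ^ 2)

/-- The dot product `x·ξ` on `ℝⁿ`. -/
def dotp {n : ℕ} (x ξ : Eu n) : ℝ := ∑ j, x j * ξ j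

/-- First-order partial derivative `∂/∂xᵢ`. -/
def pd {n : ℕ} (i : Fin n) (f : Eu n → ℝ) : Eu n → ℝ :=
  fun x => fderiv ℝ f x (EuclideanSpace.single i 1)

/-- The list of coordinate directions attached to a multi-index `γ`. -/
def mIdx {n : ℕ} (γ : Fin n → ℕ) : List (Fin n) :=
  (List.finRange n).foldr (fun i acc => List.replicate (γ i) i ++ acc) []

/-- The multi-index partial derivative `∂^γ` of a function on `ℝⁿ`. -/
def mderiv {n : ℕ} (γ : Fin n → ℕ) (f : Eu n → ℝ) : Eu n → ℝ :=
  (mIdx γ).foldr pd f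

/-- The order `|γ|` of a multi-index. -/
def mOrd {n : ℕ} (γ : Fin n → ℕ) : ℕ := ∑ i, γ i

/-- Partial derivative in the first group of variables of a function `f(x,ξ)`. -/
def pdX {n : ℕ} (i : Fin n) (f : Eu n → Eu n → ℝ) : Eu n → Eu n → ℝ :=
  fun x ξ => fderiv ℝ (fun y => f y ξ) x (EuclideanSpace.single i 1)

/-- Partial derivative in the second group of variables of a function `f(x,ξ)`. -/
def pdXi {n : ℕ} (i : Fin n) (f : Eu n → Eu n → ℝ) : Eu n → Eu n → ℝ :=
  fun x ξ => fderiv ℝ (fun η => f x η) ξ (EuclideanSpace.single i 1)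

/-- The mixed multi-index derivative `∂_x^A ∂_ξ^B` of a function `f(x,ξ)`. -/
def mderiv2 {n : ℕ} (A B : Fin n → ℕ) (f : Eu n → Eu n → ℝ) : Eu n → Eu n → ℝ :=
  (mIdx A).foldr pdX ((mIdx B).foldr pdXi f)

open scoped ContDiff

/-- Iterated directional derivatives, the last direction of the list being applied first. -/
def dirDeriv {V W : Type*} [NormedAddCommGroup V] [NormedSpace ℝ V]
    [NormedAddCommGroup W] [NormedSpace ℝ W] (L : List V) (f : V → W) : V → W :=
  L.foldr (fun h g v => fderiv ℝ g v h) f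

/-- `f` is smooth and its derivatives at `x` satisfy `‖Dᵐ f(x)‖ ≤ C m * r`. -/
def JetBound {V W : Type*} [NormedAddCommGroup V] [NormedSpace ℝ V]
    [NormedAddCommGroup W] [NormedSpace ℝ W] (f : V → W) (x : V) (C : ℕ → ℝ) (r : ℝ) : Prop :=
  ContDiff ℝ ∞ f ∧ ∀ m, ‖iteratedFDeriv ℝ m f x‖ ≤ C m * r

section Calculus

variable {V W U : Type*} [NormedAddCommGroup V] [NormedSpace ℝ V]
  [NormedAddCommGroup W] [NormedSpace ℝ W] [NormedAddCommGroup U] [NormedSpace ℝ U]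

theorem contDiff_fderiv_apply_const {f : V → W} (hf : ContDiff ℝ ∞ f) (h : V) :
    ContDiff ℝ ∞ (fun v => fderiv ℝ f v h) :=
  (hf.fderiv_right (m := ∞) (by simp)).clm_apply contDiff_const

theorem fderiv_fderiv_apply_comm {f : V → W} (hf : ContDiff ℝ ∞ f) (h k x : V) :
    fderiv ℝ (fun v => fderiv ℝ f v h) x k = fderiv ℝ (fun v => fderiv ℝ f v k) x h := by
  have hd : DifferentiableAt ℝ (fderiv ℝ f) x :=
    (hf.fderiv_right (m := ∞) (by simp)).differentiable (by simp) x
  have hs : IsSymmSndFDerivAt ℝ f x :=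
    hf.contDiffAt.isSymmSndFDerivAt (by simpa using WithTop.coe_le_coe.2 (le_top : (2 : ℕ∞) ≤ ⊤))
  rw [fderiv_clm_apply hd (differentiableAt_const _), fderiv_clm_apply hd (differentiableAt_const _)]
  simpa using hs k h

theorem contDiff_dirDeriv {f : V → W} (hf : ContDiff ℝ ∞ f) (L : List V) :
    ContDiff ℝ ∞ (dirDeriv L f) := by
  induction L with
  | nil => exact hf
  | cons h L ih => exact contDiff_fderiv_apply_const ih h

theorem dirDeriv_clm_comp {f : V → W} (hf : ContDiff ℝ ∞ f) (T : W →L[ℝ] U) (L : List V) (v : V) :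
    dirDeriv L (fun v => T (f v)) v = T (dirDeriv L f v) := by
  induction L generalizing v with
  | nil => rfl
  | cons h L ih =>
    have h1 : dirDeriv L (fun v => T (f v)) = fun v => T (dirDeriv L f v) := funext ih
    change fderiv ℝ (dirDeriv L (fun v => T (f v))) v h = T (fderiv ℝ (dirDeriv L f) v h)
    rw [h1]
    have hd : DifferentiableAt ℝ (dirDeriv L f) v :=
      (contDiff_dirDeriv hf L).differentiable (by simp) v
    have := (T.hasFDerivAt.comp v hd.hasFDerivAt).fderiv
    change fderiv ℝ (T ∘ dirDeriv L f) v h = _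
    rw [this]; rfl

theorem dirDeriv_concat (f : V → W) (L : List V) (h : V) :
    dirDeriv (L ++ [h]) f = dirDeriv L (fun v => fderiv ℝ f v h) := by
  simp [dirDeriv, List.foldr_append]

theorem JetBound.comp_clm_left {f : V → W} {x : V} {C : ℕ → ℝ} {r : ℝ} (hf : JetBound f x C r)
    (T : W →L[ℝ] U) : JetBound (fun v => T (f v)) x (fun m => ‖T‖ * C m) r := by
  refine ⟨T.contDiff.comp hf.1, fun m => ?_⟩
  have h1 := T.norm_iteratedFDeriv_comp_left (n := m) (x := x) (hf.1.contDiffAt (x := x))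
    (by exact_mod_cast le_top)
  calc _ ≤ ‖T‖ * ‖iteratedFDeriv ℝ m f x‖ := h1
    _ ≤ ‖T‖ * (C m * r) := by gcongr; exact hf.2 m
    _ = _ := by ring

theorem norm_iteratedFDeriv_comp_clm_le {f : W → U} (hf : ContDiff ℝ ∞ f) (T : V →L[ℝ] W) (x : V)
    (m : ℕ) : ‖iteratedFDeriv ℝ m (fun v => f (T v)) x‖ ≤
      ‖iteratedFDeriv ℝ m f (T x)‖ * ‖T‖ ^ m := by
  have h := T.iteratedFDeriv_comp_right hf x (i := m) (by exact_mod_cast le_top)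
  change ‖iteratedFDeriv ℝ m (f ∘ T) x‖ ≤ _
  rw [h]
  refine (ContinuousMultilinearMap.norm_compContinuousLinearMap_le _ _).trans ?_
  simp

theorem JetBound.add {f g : V → W} {x : V} {C D : ℕ → ℝ} {r : ℝ} (hf : JetBound f x C r)
    (hg : JetBound g x D r) : JetBound (fun v => f v + g v) x (fun m => C m + D m) r := by
  refine ⟨hf.1.add hg.1, fun m => ?_⟩
  have h : iteratedFDeriv ℝ m (fun v => f v + g v) x =
      iteratedFDeriv ℝ m f x + iteratedFDeriv ℝ m g x :=
    iteratedFDeriv_add_apply (hf.1.contDiffAt.of_le (by exact_mod_cast le_top))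
      (hg.1.contDiffAt.of_le (by exact_mod_cast le_top))
  rw [h, add_mul]
  exact (norm_add_le _ _).trans (add_le_add (hf.2 m) (hg.2 m))

theorem JetBound.sum {ι : Type*} {s : Finset ι} {f : ι → V → W} {x : V} {C : ι → ℕ → ℝ} {r : ℝ}
    (hf : ∀ i ∈ s, JetBound (f i) x (C i) r) :
    JetBound (fun v => ∑ i ∈ s, f i v) x (fun m => ∑ i ∈ s, C i m) r := by
  refine ⟨ContDiff.sum fun i hi => (hf i hi).1, fun m => ?_⟩
  have h : iteratedFDeriv ℝ m (fun v => ∑ i ∈ s, f i v) x =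
      ∑ i ∈ s, iteratedFDeriv ℝ m (f i) x :=
    iteratedFDeriv_fun_sum_apply fun i hi => (hf i hi).1.contDiffAt.of_le (by exact_mod_cast le_top)
  rw [h, Finset.sum_mul]
  exact (norm_sum_le _ _).trans (Finset.sum_le_sum fun i hi => (hf i hi).2 m)

theorem JetBound.congr {f : V → W} {x : V} {C D : ℕ → ℝ} {r r' : ℝ} (hf : JetBound f x C r)
    (h : ∀ m, C m * r ≤ D m * r') : JetBound f x D r' :=
  ⟨hf.1, fun m => (hf.2 m).trans (h m)⟩

theorem JetBound.mul {f g : V → ℝ} {x : V} {C D : ℕ → ℝ} {r s : ℝ} (hf : JetBound f x C r)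
    (hg : JetBound g x D s) : JetBound (fun v => f v * g v) x
      (fun m => ∑ i ∈ Finset.range (m + 1), (m.choose i : ℝ) * C i * D (m - i)) (r * s) := by
  refine ⟨hf.1.mul hg.1, fun m => ?_⟩
  refine (norm_iteratedFDeriv_mul_le (n := m) hf.1 hg.1 x (by exact_mod_cast le_top)).trans ?_
  rw [Finset.sum_mul]
  refine Finset.sum_le_sum fun i _ => ?_
  calc _ ≤ (m.choose i : ℝ) * (C i * r) * (D (m - i) * s) :=
        mul_le_mul (mul_le_mul_of_nonneg_left (hf.2 i) (by positivity)) (hg.2 _) (norm_nonneg _)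
          (mul_nonneg (by positivity) ((norm_nonneg _).trans (hf.2 i)))
    _ = _ := by ring

theorem jetBound_affine (c : W) (T : V →L[ℝ] W) (x : V) {B : ℝ} (h0 : ‖c + T x‖ ≤ B)
    (h1 : ‖T‖ ≤ B) : JetBound (fun v => c + T v) x (fun _ => B) 1 := by
  refine ⟨contDiff_const.add T.contDiff, fun m => ?_⟩
  rw [mul_one]
  match m with
  | 0 => simpa using h0
  | m + 1 =>
    rw [← norm_iteratedFDeriv_fderiv]
    have : fderiv ℝ (fun v => c + T v) = fun _ => T := by
      ext1 v
      rw [fderiv_const_add]; exact T.fderiv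
    rw [this]
    match m with
    | 0 => simpa using h1
    | m + 1 =>
      rw [iteratedFDeriv_const_of_ne (by omega)]
      simpa using (norm_nonneg _).trans h1

theorem JetBound.fderiv_clm_apply {f : W → U} {T : V →L[ℝ] W} {S : V → W} {x : V} {C : ℕ → ℝ}
    {r B : ℝ} (hf : JetBound f (T x) C r) (hT : ‖T‖ ≤ 1) (hS : JetBound S x (fun _ => B) 1) :
    JetBound (fun v => fderiv ℝ f (T v) (S v)) x
      (fun m => ∑ i ∈ Finset.range (m + 1), (m.choose i : ℝ) * C (i + 1) * B) r := by
  have hd : ContDiff ℝ ∞ (fun v => fderiv ℝ f (T v)) :=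
    (hf.1.fderiv_right (m := ∞) (by simp)).comp T.contDiff
  refine ⟨hd.clm_apply hS.1, fun m => ?_⟩
  refine (norm_iteratedFDeriv_clm_apply (n := m) hd hS.1 x
    (by exact_mod_cast le_top)).trans ?_
  rw [Finset.sum_mul]
  refine Finset.sum_le_sum fun i _ => ?_
  have h1 : ‖iteratedFDeriv ℝ i (fun v => fderiv ℝ f (T v)) x‖ ≤ C (i + 1) * r := by
    refine (norm_iteratedFDeriv_comp_clm_le (hf.1.fderiv_right (m := ∞) (by simp)) T x i).trans ?_
    rw [norm_iteratedFDeriv_fderiv]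
    calc _ ≤ ‖iteratedFDeriv ℝ (i + 1) f (T x)‖ * 1 := by
          gcongr; exact pow_le_one₀ (norm_nonneg _) hT
      _ ≤ _ := by rw [mul_one]; exact hf.2 _
  calc _ ≤ (m.choose i : ℝ) * (C (i + 1) * r) * (B * 1) :=
        mul_le_mul (mul_le_mul_of_nonneg_left h1 (by positivity)) (hS.2 _) (norm_nonneg _)
          (mul_nonneg (by positivity) ((norm_nonneg _).trans h1))
    _ = _ := by ring

theorem JetBound.comp_clm_right {f : W → U} {T : V →L[ℝ] W} {x : V} {C : ℕ → ℝ} {r : ℝ}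
    (hf : JetBound f (T x) C r) (hT : ‖T‖ ≤ 1) : JetBound (fun v => f (T v)) x C r := by
  refine ⟨hf.1.comp T.contDiff, fun m => ?_⟩
  calc _ ≤ ‖iteratedFDeriv ℝ m f (T x)‖ * ‖T‖ ^ m := norm_iteratedFDeriv_comp_clm_le hf.1 T x m
    _ ≤ ‖iteratedFDeriv ℝ m f (T x)‖ * 1 := by
          gcongr; exact pow_le_one₀ (norm_nonneg _) hT
    _ ≤ _ := by rw [mul_one]; exact hf.2 m

end Calculus

section ParametricODE

universe u v

variable {P : Type u} [NormedAddCommGroup P] [NormedSpace ℝ P]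

theorem hasDerivAt_slice {F : Type v} [NormedAddCommGroup F] [NormedSpace ℝ F] {G : ℝ × P → F}
    (hG : ContDiff ℝ ∞ G) (t : ℝ) (w : P) :
    HasDerivAt (fun s => G (s, w)) (fderiv ℝ G (t, w) (1, 0)) t :=
  ((hG.differentiable (by simp) (t, w)).hasFDerivAt).comp_hasDerivAt t
    ((hasDerivAt_id t).prodMk (hasDerivAt_const t w))

theorem hasFDerivAt_slice {F : Type v} [NormedAddCommGroup F] [NormedSpace ℝ F] {G : ℝ × P → F}
    (hG : ContDiff ℝ ∞ G) (t : ℝ) (w : P) :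
    HasFDerivAt (fun w => G (t, w))
      ((fderiv ℝ G (t, w)).comp (ContinuousLinearMap.inr ℝ ℝ P)) w :=
  ((hG.differentiable (by simp) (t, w)).hasFDerivAt).comp w
    (hasFDerivAt_prodMk_right t w)

/-- The variational equation along a smooth family of solutions. -/
theorem fderiv_variation {F : Type v} [NormedAddCommGroup F] [NormedSpace ℝ F] {G : ℝ × P → F}
    {Ψ : ℝ → P × F → F} (hG : ContDiff ℝ ∞ G)
    (hode : ∀ t w, fderiv ℝ G (t, w) (1, 0) = Ψ t (w, G (t, w)))
    (hΨ : ∀ t, ContDiff ℝ ∞ (Ψ t)) (h : P) (t : ℝ) (w : P) :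
    fderiv ℝ (fun v => fderiv ℝ G v (0, h)) (t, w) (1, 0) =
      fderiv ℝ (Ψ t) (w, G (t, w)) (h, fderiv ℝ G (t, w) (0, h)) := by
  rw [fderiv_fderiv_apply_comm hG]
  have h1 := hasFDerivAt_slice (contDiff_fderiv_apply_const hG ((1 : ℝ), (0 : P))) t w
  have h2 : (fun w => fderiv ℝ G (t, w) (1, 0)) = fun w => Ψ t (w, G (t, w)) :=
    funext fun w => hode t w
  have h3 : HasFDerivAt (fun w => Ψ t (w, G (t, w))) _ w :=
    (((hΨ t).differentiable (by simp) (w, G (t, w))).hasFDerivAt).comp w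
      ((hasFDerivAt_id w).prodMk (hasFDerivAt_slice hG t w))
  rw [h2] at h1
  have := congrArg (fun T => T h) (h1.unique h3)
  simpa using this

theorem norm_le_of_norm_deriv_le {F : Type v} [NormedAddCommGroup F] [NormedSpace ℝ F]
    {f f' : ℝ → F} {r ρ : ℝ → ℝ} {K : ℝ} (hf : ∀ t, HasDerivAt f (f' t) t) (h0 : f 0 = 0)
    (hr0 : r 0 = 0) (hr : ∀ t, 0 ≤ t → HasDerivAt r (ρ t) t)
    (hb : ∀ t, 0 ≤ t → ‖f' t‖ ≤ K * ρ t) (t : ℝ) (ht : 0 ≤ t) : ‖f t‖ ≤ K * r t := by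
  refine image_norm_le_of_norm_deriv_right_le_deriv_boundary' (a := 0) (b := t) (f := f) (f' := f')
    (B := fun t => K * r t) (B' := fun t => K * ρ t)
    (fun s _ => (hf s).continuousAt.continuousWithinAt) (fun s _ => (hf s).hasDerivWithinAt)
    (by simp [h0, hr0])
    (fun s hs => ((hr s hs.1).const_mul K).continuousAt.continuousWithinAt)
    (fun s hs => ((hr s hs.1).const_mul K).hasDerivWithinAt) (fun s hs => hb s hs.1) ⟨ht, le_rfl⟩

/-- A Grönwall inequality with an integrable coefficient. -/
theorem norm_le_exp_of_norm_deriv_le {F : Type v} [NormedAddCommGroup F] [NormedSpace ℝ F]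
    {f f' : ℝ → F} {r ρ : ℝ → ℝ} {K : ℝ} (hf : ∀ t, HasDerivAt f (f' t) t) (h0 : f 0 = 0)
    (hr0 : r 0 = 0) (hr : ∀ t, 0 ≤ t → HasDerivAt r (ρ t) t) (hρ : ∀ t, 0 ≤ t → 0 < ρ t)
    (hb : ∀ t, 0 ≤ t → ‖f' t‖ ≤ K * ρ t * (1 + ‖f t‖)) (t : ℝ) (ht : 0 ≤ t) :
    ‖f t‖ ≤ Real.exp ((K + 1) * r t) - 1 := by
  have hB : ∀ s, 0 ≤ s → HasDerivAt (fun s => Real.exp ((K + 1) * r s) - 1)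
      (Real.exp ((K + 1) * r s) * ((K + 1) * ρ s)) s := fun s hs =>
    (((hr s hs).const_mul (K + 1)).exp).sub_const 1
  refine image_norm_le_of_norm_deriv_right_lt_deriv_boundary' (a := 0) (b := t) (f := f) (f' := f')
    (B := fun s => Real.exp ((K + 1) * r s) - 1)
    (B' := fun s => Real.exp ((K + 1) * r s) * ((K + 1) * ρ s))
    (fun s _ => (hf s).continuousAt.continuousWithinAt) (fun s _ => (hf s).hasDerivWithinAt)
    (by simp [h0, hr0])
    (fun s hs => (hB s hs.1).continuousAt.continuousWithinAt)
    (fun s hs => (hB s hs.1).hasDerivWithinAt) (fun s hs he => ?_) ⟨ht, le_rfl⟩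
  have h1 := hb s hs.1
  rw [he] at h1
  have h2 : 0 < ρ s * Real.exp ((K + 1) * r s) := mul_pos (hρ s hs.1) (Real.exp_pos _)
  nlinarith

/-- Derivatives in the parameter of a family of solutions of `∂ₜG = Ψ t (w, G)` with vanishing
initial data are controlled by the jets of `Ψ` along one trajectory. -/
theorem exists_dirDeriv_bound (k : ℕ) : ∀ (C : ℕ → ℝ) (R : ℝ), ∃ K : ℝ, 0 < K ∧
    ∀ (F : Type v) [NormedAddCommGroup F] [NormedSpace ℝ F] (G : ℝ × P → F) (Ψ : ℝ → P × F → F)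
      (w₀ : P) (r ρ : ℝ → ℝ), ContDiff ℝ ∞ G →
      (∀ t w, fderiv ℝ G (t, w) (1, 0) = Ψ t (w, G (t, w))) → (∀ w, G (0, w) = 0) →
      r 0 = 0 → (∀ t, 0 ≤ t → HasDerivAt r (ρ t) t) → (∀ t, 0 ≤ t → 0 < ρ t) →
      (∀ t, 0 ≤ t → 0 ≤ r t) → (∀ t, 0 ≤ t → r t ≤ R) → (∀ t, ContDiff ℝ ∞ (Ψ t)) →
      (∀ t, 0 ≤ t → JetBound (Ψ t) (w₀, G (t, w₀)) C (ρ t)) →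
      ∀ L : List P, L.length = k → (∀ h ∈ L, ‖h‖ ≤ 1) →
      ∀ t, 0 ≤ t → ‖dirDeriv (L.map fun h => ((0 : ℝ), h)) G (t, w₀)‖ ≤ K * r t := by
  induction k with
  | zero =>
    intro C R
    refine ⟨|C 0| + 1, by positivity, ?_⟩
    intro F _ _ G Ψ w₀ r ρ hG hode hG0 hr0 hr hρ hrn hrR hΨ hJ L hL _ t ht
    obtain rfl := List.length_eq_zero_iff.1 hL
    refine norm_le_of_norm_deriv_le (f := fun t => G (t, w₀)) (fun t => hasDerivAt_slice hG t w₀)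
      (hG0 w₀) hr0 hr (fun s hs => ?_) t ht
    rw [hode]
    have h1 := (hJ s hs).2 0
    rw [norm_iteratedFDeriv_zero] at h1
    have h2 := hρ s hs
    exact h1.trans (mul_le_mul_of_nonneg_right ((le_abs_self _).trans (by linarith)) h2.le)
  | succ k ih =>
    intro C R
    set B : ℝ := Real.exp ((|C 1| + 1) * R) + 1 with hB
    have hB1 : 1 ≤ B := by rw [hB]; linarith [Real.exp_pos ((|C 1| + 1) * R)]
    obtain ⟨K, hK0, hK⟩ := ih (fun m => C m +
      ∑ i ∈ Finset.range (m + 1), (m.choose i : ℝ) * C (i + 1) * B) R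
    refine ⟨K, hK0, ?_⟩
    intro F _ _ G Ψ w₀ r ρ hG hode hG0 hr0 hr hρ hrn hrR hΨ hJ L hL hL1 t ht
    obtain ⟨L', h, rfl⟩ := (List.eq_nil_or_concat L).resolve_left (by rintro rfl; simp at hL)
    have hh : ‖h‖ ≤ 1 := hL1 h (by simp)
    set G₁ : ℝ × P → F := fun v => fderiv ℝ G v (0, h) with hG₁
    have hG₁s : ContDiff ℝ ∞ G₁ := contDiff_fderiv_apply_const hG _
    have hvar := fderiv_variation hG hode hΨ h
    have hG₁0 : ∀ w, G₁ (0, w) = 0 := by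
      intro w
      have h1 := hasFDerivAt_slice hG 0 w
      have h2 : (fun w => G (0, w)) = fun _ => 0 := funext hG0
      rw [h2] at h1
      have := congrArg (fun T => T h) (h1.unique (hasFDerivAt_const 0 w))
      simpa using this
    have hG₁b : ∀ s, 0 ≤ s → ‖G₁ (s, w₀)‖ ≤ B := by
      intro s hs
      have h1 := norm_le_exp_of_norm_deriv_le (f := fun s => G₁ (s, w₀)) (K := |C 1|)
        (fun t => hasDerivAt_slice hG₁s t w₀) (hG₁0 w₀) hr0 hr hρ (fun s hs => ?_) s hs
      · have h2 : Real.exp ((|C 1| + 1) * r s) ≤ Real.exp ((|C 1| + 1) * R) :=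
          Real.exp_le_exp.2 (mul_le_mul_of_nonneg_left (hrR s hs) (by positivity))
        rw [hB]; linarith
      · rw [hvar]
        have h2 := (hJ s hs).2 1
        rw [← norm_iteratedFDeriv_fderiv, norm_iteratedFDeriv_zero] at h2
        refine (ContinuousLinearMap.le_opNorm _ _).trans ?_
        have h3 := hρ s hs
        refine mul_le_mul (h2.trans (mul_le_mul_of_nonneg_right (le_abs_self _) h3.le)) ?_
          (norm_nonneg _) (by positivity)
        rw [Prod.norm_mk]
        exact max_le (by linarith [norm_nonneg (G₁ (s, w₀))]) (by
          change ‖G₁ (s, w₀)‖ ≤ _; linarith)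
    let π : P × (F × F) →L[ℝ] P × F := (ContinuousLinearMap.fst ℝ P (F × F)).prod
      ((ContinuousLinearMap.fst ℝ F F).comp (ContinuousLinearMap.snd ℝ P (F × F)))
    let π₁ : P × (F × F) →L[ℝ] P × F := (ContinuousLinearMap.inr ℝ P F).comp
      ((ContinuousLinearMap.snd ℝ F F).comp (ContinuousLinearMap.snd ℝ P (F × F)))
    have hπ : ‖π‖ ≤ 1 := by
      refine ContinuousLinearMap.opNorm_le_bound _ zero_le_one fun x => ?_
      rw [one_mul]
      exact max_le (le_max_left _ _) ((le_max_left _ _).trans (le_max_right ‖x.1‖ ‖x.2‖))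
    have hπ₁ : ‖π₁‖ ≤ 1 := by
      refine ContinuousLinearMap.opNorm_le_bound _ zero_le_one fun x => ?_
      rw [one_mul]
      exact max_le (norm_zero.trans_le (norm_nonneg x))
        ((le_max_right _ _).trans (le_max_right ‖x.1‖ ‖x.2‖))
    have hJ' : ∀ t, 0 ≤ t → JetBound (fun x : P × (F × F) =>
        (Ψ t (π x), fderiv ℝ (Ψ t) (π x) ((h, 0) + π₁ x))) (w₀, (G (t, w₀), G₁ (t, w₀)))
        (fun m => C m + ∑ i ∈ Finset.range (m + 1), (m.choose i : ℝ) * C (i + 1) * B) (ρ t) := by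
      intro t ht
      have hS : JetBound (fun x => ((h, 0) : P × F) + π₁ x) (w₀, (G (t, w₀), G₁ (t, w₀)))
          (fun _ => B) 1 := by
        refine jetBound_affine _ π₁ _ ?_ (hπ₁.trans hB1)
        have : ((h, 0) : P × F) + π₁ (w₀, (G (t, w₀), G₁ (t, w₀))) = (h, G₁ (t, w₀)) := by
          simp [π₁]
        rw [this]
        exact max_le (hh.trans hB1) (hG₁b t ht)
      have e1 := (((hJ t ht).comp_clm_right (T := π) (x := (w₀, (G (t, w₀), G₁ (t, w₀))))
        hπ)).comp_clm_left (ContinuousLinearMap.inl ℝ F F)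
      have e2 := (((hJ t ht).fderiv_clm_apply (T := π) (x := (w₀, (G (t, w₀), G₁ (t, w₀))))
        hπ hS)).comp_clm_left (ContinuousLinearMap.inr ℝ F F)
      have hin : ‖ContinuousLinearMap.inl ℝ F F‖ ≤ 1 :=
        ContinuousLinearMap.opNorm_le_bound _ zero_le_one fun x => by simp
      have hir : ‖ContinuousLinearMap.inr ℝ F F‖ ≤ 1 :=
        ContinuousLinearMap.opNorm_le_bound _ zero_le_one fun x => by simp
      have hCn : ∀ m, 0 ≤ C m := fun m => by
        by_contra hneg
        have := ((norm_nonneg _).trans ((hJ t ht).2 m))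
        nlinarith [hρ t ht]
      have e3 := e1.add e2
      have hfun : (fun x : P × (F × F) =>
          (Ψ t (π x), fderiv ℝ (Ψ t) (π x) ((h, 0) + π₁ x))) = fun x =>
          ContinuousLinearMap.inl ℝ F F (Ψ t (π x)) +
            ContinuousLinearMap.inr ℝ F F (fderiv ℝ (Ψ t) (π x) ((h, 0) + π₁ x)) := by
        ext x <;> simp
      rw [hfun]
      refine e3.congr (fun m => mul_le_mul_of_nonneg_right ?_ (hρ t ht).le)
      have hs : 0 ≤ ∑ i ∈ Finset.range (m + 1), (m.choose i : ℝ) * C (i + 1) * B :=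
        Finset.sum_nonneg fun i _ =>
          mul_nonneg (mul_nonneg (by positivity) (hCn _)) (by linarith)
      exact add_le_add (mul_le_of_le_one_left (hCn m) hin) (mul_le_of_le_one_left hs hir)
    have hG' : ContDiff ℝ ∞ fun v => (G v, G₁ v) := hG.prodMk hG₁s
    have key := hK (F × F) (fun v => (G v, G₁ v)) (fun t x =>
        (Ψ t (π x), fderiv ℝ (Ψ t) (π x) ((h, 0) + π₁ x))) w₀ r ρ hG' (fun t w => ?_)
      (fun w => by simp [hG0, hG₁0]) hr0 hr hρ hrn hrR (fun t => ?_) hJ' L' (by simpa using hL)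
      (fun h hh => hL1 h (by simp [hh])) t ht
    · rw [List.concat_eq_append, List.map_append, List.map_singleton, dirDeriv_concat]
      refine le_trans ?_ key
      have h1 := dirDeriv_clm_comp hG' (ContinuousLinearMap.snd ℝ F F)
        (L'.map fun h => ((0 : ℝ), h)) (t, w₀)
      change ‖dirDeriv (L'.map fun h => ((0 : ℝ), h)) G₁ (t, w₀)‖ ≤ _
      have h2 : dirDeriv (L'.map fun h => ((0 : ℝ), h)) G₁ (t, w₀) =
        (dirDeriv (L'.map fun h => ((0 : ℝ), h)) (fun v => (G v, G₁ v)) (t, w₀)).2 := h1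
      rw [h2]
      exact le_max_right _ _
    · have h1 := ((hG.differentiable (by simp) (t, w)).hasFDerivAt.prodMk
        (hG₁s.differentiable (by simp) (t, w)).hasFDerivAt).fderiv
      rw [h1, ContinuousLinearMap.prod_apply, hode, hvar]
      simp [π, π₁, hG₁]
    · exact ((hΨ t).comp π.contDiff).prodMk
        ((((hΨ t).fderiv_right (m := ∞) (by simp)).comp π.contDiff).clm_apply
          (contDiff_const.add π₁.contDiff))

end ParametricODE

section Coordinates

variable {n : ℕ}

theorem foldr_pd_eq_dirDeriv (L : List (Fin n)) (f : Eu n → ℝ) :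
    L.foldr pd f = dirDeriv (L.map fun i => EuclideanSpace.single i (1 : ℝ)) f := by
  induction L with
  | nil => rfl
  | cons i L ih => rw [List.foldr_cons, ih]; rfl

theorem contDiff_foldr_pd {f : Eu n → ℝ} (hf : ContDiff ℝ ∞ f) (L : List (Fin n)) :
    ContDiff ℝ ∞ (L.foldr pd f) := by
  rw [foldr_pd_eq_dirDeriv]; exact contDiff_dirDeriv hf _

theorem foldr_pd_perm {f : Eu n → ℝ} (hf : ContDiff ℝ ∞ f) {L L' : List (Fin n)}
    (h : L.Perm L') : L.foldr pd f = L'.foldr pd f := by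
  induction h with
  | nil => rfl
  | cons i _ ih => rw [List.foldr_cons, ih, List.foldr_cons]
  | swap i j L =>
    ext x
    exact fderiv_fderiv_apply_comm (contDiff_foldr_pd hf L) _ _ x
  | trans _ _ ih1 ih2 => exact ih1.trans ih2

theorem count_mIdx (γ : Fin n → ℕ) (i : Fin n) : (mIdx γ).count i = γ i := by
  have h : ∀ l : List (Fin n), (l.foldr (fun i acc => List.replicate (γ i) i ++ acc) []).count i =
      l.count i * γ i := by
    intro l
    induction l with
    | nil => simp
    | cons j l ih =>
      rw [List.foldr_cons, List.count_append, ih, List.count_replicate, List.count_cons]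
      by_cases hij : j = i
      · subst hij; simp; ring
      · simp [hij]
  rw [mIdx, h, List.count_eq_one_of_mem (List.nodup_finRange n) (List.mem_finRange i), one_mul]

theorem length_mIdx (γ : Fin n → ℕ) : (mIdx γ).length = mOrd γ := by
  have h : ∀ l : List (Fin n), (l.foldr (fun i acc => List.replicate (γ i) i ++ acc) []).length =
      (l.map γ).sum := by
    intro l
    induction l with
    | nil => simp
    | cons j l ih => rw [List.foldr_cons, List.length_append, ih]; simp
  rw [mIdx, h, mOrd, Fin.sum_univ_def]

theorem foldr_pd_eq_mderiv {f : Eu n → ℝ} (hf : ContDiff ℝ ∞ f) (L : List (Fin n)) :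
    L.foldr pd f = mderiv (fun i => L.count i) f :=
  foldr_pd_perm hf (List.perm_iff_count.2 fun i => (count_mIdx (fun i => L.count i) i).symm)

theorem sum_count_eq_length (L : List (Fin n)) : ∑ i, L.count i = L.length := by
  have h1 : L.Perm (mIdx fun i => L.count i) :=
    List.perm_iff_count.2 fun i => (count_mIdx (fun i => L.count i) i).symm
  rw [h1.length_eq, length_mIdx, mOrd]

theorem fderiv_eq_sum_pd (f : Eu n → ℝ) (x : Eu n) :
    fderiv ℝ f x = ∑ i, pd i f x • (EuclideanSpace.proj i : Eu n →L[ℝ] ℝ) := by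
  ext v
  have hv : v = ∑ i, v i • EuclideanSpace.single i (1 : ℝ) := by
    ext j; simp [Finset.sum_apply, Pi.single_apply]
  conv_lhs => rw [hv]
  simp [pd, mul_comm]

theorem norm_euclideanProj_le (i : Fin n) : ‖(EuclideanSpace.proj i : Eu n →L[ℝ] ℝ)‖ ≤ 1 :=
  ContinuousLinearMap.opNorm_le_bound _ zero_le_one fun x => by
    simpa using PiLp.norm_apply_le x i

theorem norm_iteratedFDeriv_le_of_foldr_pd {ℓ : ℕ} {K : ℝ} {x : Eu n} {f : Eu n → ℝ}
    (hf : ContDiff ℝ ∞ f) (h : ∀ L : List (Fin n), L.length = ℓ → |L.foldr pd f x| ≤ K) :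
    ‖iteratedFDeriv ℝ ℓ f x‖ ≤ (n : ℝ) ^ ℓ * K := by
  induction ℓ generalizing f with
  | zero => simpa using h [] rfl
  | succ ℓ ih =>
    have hpd : ∀ i, ContDiff ℝ ∞ (pd i f) := fun i => contDiff_fderiv_apply_const hf _
    rw [← norm_iteratedFDeriv_fderiv, funext (fderiv_eq_sum_pd f)]
    have hs : ∀ i : Fin n, ContDiff ℝ ∞
        (fun x => pd i f x • (EuclideanSpace.proj i : Eu n →L[ℝ] ℝ)) := fun i =>
      (hpd i).smul contDiff_const
    rw [iteratedFDeriv_fun_sum_apply fun i _ => (hs i).contDiffAt.of_le (by exact_mod_cast le_top)]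
    refine (norm_sum_le _ _).trans ?_
    have hi : ∀ i ∈ (Finset.univ : Finset (Fin n)), ‖iteratedFDeriv ℝ ℓ
        (fun x => pd i f x • (EuclideanSpace.proj i : Eu n →L[ℝ] ℝ)) x‖ ≤ (n : ℝ) ^ ℓ * K := by
      intro i _
      have h1 := (ContinuousLinearMap.toSpanSingleton ℝ
        (EuclideanSpace.proj i : Eu n →L[ℝ] ℝ)).norm_iteratedFDeriv_comp_left (n := ℓ) (x := x)
        ((hpd i).contDiffAt (x := x)) (by exact_mod_cast le_top)
      have h2 := ih (hpd i) fun L hL => by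
        have := h (L ++ [i]) (by simp [hL])
        simpa [List.foldr_append] using this
      refine h1.trans (le_trans (mul_le_of_le_one_left (norm_nonneg _) ?_) h2)
      rw [ContinuousLinearMap.norm_toSpanSingleton]
      exact norm_euclideanProj_le i
    refine (Finset.sum_le_sum hi).trans (le_of_eq ?_)
    simp; ring

theorem norm_iteratedFDeriv_coeff_le {b : Fin n → Fin n → Eu n → ℝ} {A : ℕ → ℝ} {σ₀ : ℝ}
    (hb : ∀ j k, ContDiff ℝ ∞ (b j k))
    (hA : ∀ (ℓ : ℕ) (x : Eu n),
      (∑ γ ∈ Finset.Nat.antidiagonalTuple n ℓ, ∑ j, ∑ k', |mderiv γ (b j k') x|) ≤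
        A ℓ * jb x ^ (-(1 + (ℓ : ℝ) + σ₀))) (j k : Fin n) (ℓ : ℕ) (x : Eu n) :
    ‖iteratedFDeriv ℝ ℓ (b j k) x‖ ≤ (n : ℝ) ^ ℓ * (A ℓ * jb x ^ (-(1 + (ℓ : ℝ) + σ₀))) := by
  refine norm_iteratedFDeriv_le_of_foldr_pd (hb j k) fun L hL => ?_
  rw [foldr_pd_eq_mderiv (hb j k)]
  have hmem : (fun i => L.count i) ∈ Finset.Nat.antidiagonalTuple n ℓ := by
    rw [Finset.Nat.mem_antidiagonalTuple, sum_count_eq_length, hL]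
  refine le_trans ?_ (hA ℓ x)
  refine le_trans ?_ (Finset.single_le_sum
    (f := fun γ => ∑ j, ∑ k', |mderiv γ (b j k') x|) (fun γ _ => by positivity) hmem)
  refine le_trans ?_ (Finset.single_le_sum
    (f := fun j => ∑ k', |mderiv (fun i => L.count i) (b j k') x|)
    (fun j _ => by positivity) (Finset.mem_univ j))
  exact Finset.single_le_sum (f := fun k' => |mderiv (fun i => L.count i) (b j k') x|)
    (fun j _ => by positivity) (Finset.mem_univ k)

theorem pdX_eq_fderiv {g : ℝ → Eu n → Eu n → ℝ}
    (hg : ContDiff ℝ ∞ fun q : ℝ × Eu n × Eu n => g q.1 q.2.1 q.2.2) (i : Fin n) (t : ℝ)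
    (x ξ : Eu n) : pdX i (g t) x ξ =
      fderiv ℝ (fun q : ℝ × Eu n × Eu n => g q.1 q.2.1 q.2.2) (t, x, ξ)
        (0, EuclideanSpace.single i 1, 0) := by
  have h : HasFDerivAt (fun y => g t y ξ) _ x :=
    HasFDerivAt.comp (f := fun y => (t, y, ξ)) x
      (hg.differentiable (by simp) (t, x, ξ)).hasFDerivAt
      ((hasFDerivAt_const t x).prodMk ((hasFDerivAt_id x).prodMk (hasFDerivAt_const ξ x)))
  rw [pdX, h.fderiv]
  simp

theorem pdXi_eq_fderiv {g : ℝ → Eu n → Eu n → ℝ}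
    (hg : ContDiff ℝ ∞ fun q : ℝ × Eu n × Eu n => g q.1 q.2.1 q.2.2) (i : Fin n) (t : ℝ)
    (x ξ : Eu n) : pdXi i (g t) x ξ =
      fderiv ℝ (fun q : ℝ × Eu n × Eu n => g q.1 q.2.1 q.2.2) (t, x, ξ)
        (0, 0, EuclideanSpace.single i 1) := by
  have h : HasFDerivAt (fun y => g t x y) _ ξ :=
    HasFDerivAt.comp (f := fun y => (t, x, y)) ξ
      (hg.differentiable (by simp) (t, x, ξ)).hasFDerivAt
      ((hasFDerivAt_const t ξ).prodMk ((hasFDerivAt_const x ξ).prodMk (hasFDerivAt_id ξ)))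
  rw [pdXi, h.fderiv]
  simp

theorem contDiff_foldr_pdXi {g : ℝ → Eu n → Eu n → ℝ}
    (hg : ContDiff ℝ ∞ fun q : ℝ × Eu n × Eu n => g q.1 q.2.1 q.2.2) (L : List (Fin n)) :
    ContDiff ℝ ∞ fun q : ℝ × Eu n × Eu n => L.foldr pdXi (g q.1) q.2.1 q.2.2 := by
  induction L with
  | nil => exact hg
  | cons i L ih =>
    simp only [List.foldr_cons]
    simp_rw [fun q : ℝ × Eu n × Eu n => pdXi_eq_fderiv (g := fun t => L.foldr pdXi (g t)) ih i q.1 q.2.1 q.2.2]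
    exact contDiff_fderiv_apply_const ih _

theorem contDiff_foldr_pdX {g : ℝ → Eu n → Eu n → ℝ}
    (hg : ContDiff ℝ ∞ fun q : ℝ × Eu n × Eu n => g q.1 q.2.1 q.2.2) (L : List (Fin n)) :
    ContDiff ℝ ∞ fun q : ℝ × Eu n × Eu n => L.foldr pdX (g q.1) q.2.1 q.2.2 := by
  induction L with
  | nil => exact hg
  | cons i L ih =>
    simp only [List.foldr_cons]
    simp_rw [fun q : ℝ × Eu n × Eu n => pdX_eq_fderiv (g := fun t => L.foldr pdX (g t)) ih i q.1 q.2.1 q.2.2]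
    exact contDiff_fderiv_apply_const ih _

theorem fderiv_scaled {g : ℝ → Eu n → Eu n → ℝ}
    (hg : ContDiff ℝ ∞ fun q : ℝ × Eu n × Eu n => g q.1 q.2.1 q.2.2) (a : ℝ)
    (v h : ℝ × Eu n × Eu n) :
    fderiv ℝ (fun v : ℝ × Eu n × Eu n => g v.1 (a • v.2.1) v.2.2) v h =
      fderiv ℝ (fun q : ℝ × Eu n × Eu n => g q.1 q.2.1 q.2.2) (v.1, a • v.2.1, v.2.2)
        (h.1, a • h.2.1, h.2.2) := by
  have h1 : HasFDerivAt (fun v : ℝ × Eu n × Eu n => g v.1 (a • v.2.1) v.2.2) _ v :=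
    HasFDerivAt.comp (f := fun v : ℝ × Eu n × Eu n => (v.1, a • v.2.1, v.2.2)) v
      (hg.differentiable (by simp) (v.1, a • v.2.1, v.2.2)).hasFDerivAt
      (hasFDerivAt_fst.prodMk ((hasFDerivAt_snd.fst.const_smul a).prodMk hasFDerivAt_snd.snd))
  rw [h1.fderiv]
  simp

theorem dirDeriv_scaled {g : ℝ → Eu n → Eu n → ℝ}
    (hg : ContDiff ℝ ∞ fun q : ℝ × Eu n × Eu n => g q.1 q.2.1 q.2.2) (a : ℝ)
    (LA LB : List (Fin n)) :
    dirDeriv ((LA.map fun i => ((EuclideanSpace.single i (1 : ℝ) : Eu n), (0 : Eu n))) ++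
        (LB.map fun i => ((0 : Eu n), (EuclideanSpace.single i (1 : ℝ) : Eu n))) |>.map
          fun h => ((0 : ℝ), h))
      (fun v : ℝ × Eu n × Eu n => g v.1 (a • v.2.1) v.2.2) =
    fun v => a ^ LA.length * LA.foldr pdX (LB.foldr pdXi (g v.1)) (a • v.2.1) v.2.2 := by
  induction LA with
  | nil =>
    simp only [List.map_nil, List.nil_append, List.length_nil, pow_zero, one_mul, List.foldr_nil]
    induction LB with
    | nil => rfl
    | cons i L ih =>
      have hL := contDiff_foldr_pdXi hg L
      funext v
      simp only [List.map_cons, dirDeriv, List.foldr_cons] at ih ⊢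
      rw [ih, fderiv_scaled (g := fun t => L.foldr pdXi (g t)) hL,
        pdXi_eq_fderiv (g := fun t => L.foldr pdXi (g t)) hL]
      simp
  | cons i L ih =>
    have hL := contDiff_foldr_pdX (g := fun t => LB.foldr pdXi (g t)) (contDiff_foldr_pdXi hg LB) L
    funext v
    simp only [List.map_cons, List.cons_append, dirDeriv, List.foldr_cons, List.length_cons]
      at ih ⊢
    rw [ih, pdX_eq_fderiv (g := fun t => L.foldr pdX (LB.foldr pdXi (g t))) hL]
    have hs : DifferentiableAt ℝ (fun v : ℝ × Eu n × Eu n =>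
        L.foldr pdX (LB.foldr pdXi (g v.1)) (a • v.2.1) v.2.2) v := by
      refine ((hL.comp (?_ : ContDiff ℝ ∞ fun v : ℝ × Eu n × Eu n =>
        (v.1, a • v.2.1, v.2.2))).differentiable (by simp)) v
      fun_prop
    rw [fderiv_const_mul hs, smul_apply,
      fderiv_scaled (g := fun t => L.foldr pdX (LB.foldr pdXi (g t))) hL]
    have : ((0 : ℝ), a • (EuclideanSpace.single i (1 : ℝ) : Eu n), (0 : Eu n)) =
        a • ((0 : ℝ), (EuclideanSpace.single i (1 : ℝ) : Eu n), (0 : Eu n)) := by simp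
    rw [this, map_smul]
    simp only [smul_eq_mul]
    ring

end Coordinates

section Trajectories

variable {n : ℕ}

/-- The quadratic form `q(x,ξ) = ∑ b_{jk}(x) ξ_j ξ_k`. -/
def symbolForm (b : Fin n → Fin n → Eu n → ℝ) (x ξ : Eu n) : ℝ :=
  ∑ j, ∑ k, b j k x * ξ j * ξ k

/-- The gradient of `q` in `x`. -/
def symbolGradX (b : Fin n → Fin n → Eu n → ℝ) (x ξ : Eu n) : Eu n :=
  WithLp.toLp 2 fun i => ∑ j, ∑ k, pd i (b j k) x * ξ j * ξ k

/-- The gradient of `q` in `ξ`. -/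
def symbolGradXi (b : Fin n → Fin n → Eu n → ℝ) (x ξ : Eu n) : Eu n :=
  WithLp.toLp 2 fun i => ∑ j, (b i j x + b j i x) * ξ j

theorem one_le_jb (x : Eu n) : 1 ≤ jb x := by
  rw [jb]; exact Real.one_le_sqrt.2 (by nlinarith [sq_nonneg ‖x‖])

theorem jb_sq (x : Eu n) : jb x ^ 2 = 1 + ‖x‖ ^ 2 := by
  rw [jb]; exact Real.sq_sqrt (by positivity)

theorem norm_le_jb (x : Eu n) : ‖x‖ ≤ jb x := by
  rw [jb]; exact Real.le_sqrt_of_sq_le (by linarith)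

theorem dotp_eq_inner (x ξ : Eu n) : dotp x ξ = inner ℝ x ξ := by
  simp [dotp, PiLp.inner_apply, mul_comm]

theorem hasDerivAt_apply {X : ℝ → Eu n} {x' : Eu n} {t : ℝ} (hX : HasDerivAt X x' t) (i : Fin n) :
    HasDerivAt (fun t => X t i) (x' i) t :=
  (EuclideanSpace.proj i : Eu n →L[ℝ] ℝ).hasFDerivAt.comp_hasDerivAt t hX

theorem hasDerivAt_of_apply {X : ℝ → Eu n} {x' : Eu n} {t : ℝ}
    (h : ∀ i, HasDerivAt (fun t => X t i) (x' i) t) : HasDerivAt X x' t := by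
  have h' := hasDerivAt_pi.2 h
  exact (EuclideanSpace.equiv (Fin n) ℝ).symm.hasFDerivAt.comp_hasDerivAt t h'

theorem hasDerivAt_symbolForm {b : Fin n → Fin n → Eu n → ℝ} (hb : ∀ j k, ContDiff ℝ ∞ (b j k))
    {X Ξ : ℝ → Eu n} {x' ξ' : Eu n} {t : ℝ} (hX : HasDerivAt X x' t) (hΞ : HasDerivAt Ξ ξ' t) :
    HasDerivAt (fun t => symbolForm b (X t) (Ξ t))
      (inner ℝ (symbolGradX b (X t) (Ξ t)) x' + inner ℝ (symbolGradXi b (X t) (Ξ t)) ξ') t := by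
  have h1 : ∀ j k, HasDerivAt (fun t => b j k (X t)) (fderiv ℝ (b j k) (X t) x') t := fun j k =>
    ((hb j k).differentiable (by simp) (X t)).hasFDerivAt.comp_hasDerivAt t hX
  have h2 : HasDerivAt (fun t => symbolForm b (X t) (Ξ t)) _ t :=
    HasDerivAt.fun_sum fun j _ => HasDerivAt.fun_sum fun k _ =>
      ((h1 j k).fun_mul (hasDerivAt_apply hΞ j)).fun_mul (hasDerivAt_apply hΞ k)
  convert h2 using 1
  have e1 : inner ℝ (symbolGradX b (X t) (Ξ t)) x' =
      ∑ j, ∑ k, fderiv ℝ (b j k) (X t) x' * Ξ t j * Ξ t k := by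
    have : ∀ j k, fderiv ℝ (b j k) (X t) x' * Ξ t j * Ξ t k =
        ∑ i, x' i * (pd i (b j k) (X t) * Ξ t j * Ξ t k) := by
      intro j k
      rw [fderiv_eq_sum_pd]
      simp only [sum_apply, smul_apply, PiLp.proj_apply,
        smul_eq_mul, Finset.sum_mul]
      exact Finset.sum_congr rfl fun i _ => by ring
    simp only [this, symbolGradX, PiLp.inner_apply, RCLike.inner_apply, conj_trivial,
      Finset.mul_sum]
    rw [Finset.sum_comm]
    exact Finset.sum_congr rfl fun j _ => Finset.sum_comm
  have e2 : inner ℝ (symbolGradXi b (X t) (Ξ t)) ξ' =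
      ∑ j, ∑ k, (b j k (X t) * ξ' j * Ξ t k + b j k (X t) * Ξ t j * ξ' k) := by
    simp only [symbolGradXi, PiLp.inner_apply, RCLike.inner_apply, conj_trivial,
      Finset.mul_sum, Finset.sum_add_distrib, add_mul, mul_add]
    congr 1
    · exact Finset.sum_congr rfl fun i _ => Finset.sum_congr rfl fun j _ => by ring
    · rw [Finset.sum_comm]
      exact Finset.sum_congr rfl fun i _ => Finset.sum_congr rfl fun j _ => by ring
  rw [e1, e2, ← Finset.sum_add_distrib]
  refine Finset.sum_congr rfl fun j _ => ?_
  rw [← Finset.sum_add_distrib]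
  exact Finset.sum_congr rfl fun k _ => by ring

theorem differentiable_symbol {b : Fin n → Fin n → Eu n → ℝ} (hb : ∀ j k, ContDiff ℝ ∞ (b j k))
    (ε : ℝ) : ContDiff ℝ ∞ (fun v : Eu n × Eu n => ‖v.2‖ ^ 2 + ε * symbolForm b v.1 v.2) := by
  have h1 : ∀ j, ContDiff ℝ ∞ (fun v : Eu n × Eu n => v.2 j) := fun j =>
    (EuclideanSpace.proj j : Eu n →L[ℝ] ℝ).contDiff.comp contDiff_snd
  refine (contDiff_snd.norm_sq ℝ).add (contDiff_const.mul ?_)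
  exact ContDiff.sum fun j _ => ContDiff.sum fun k _ =>
    (((hb j k).comp contDiff_fst).mul (h1 j)).mul (h1 k)

theorem fderiv_symbol_right {b : Fin n → Fin n → Eu n → ℝ} (hb : ∀ j k, ContDiff ℝ ∞ (b j k))
    (ε : ℝ) (x ξ : Eu n) (i : Fin n) :
    fderiv ℝ (fun η => ‖η‖ ^ 2 + ε * symbolForm b x η) ξ (EuclideanSpace.single i 1) =
      2 * ξ i + ε * symbolGradXi b x ξ i := by
  set e : Eu n := EuclideanSpace.single i 1
  have hd : DifferentiableAt ℝ (fun η => ‖η‖ ^ 2 + ε * symbolForm b x η) ξ :=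
    ((differentiable_symbol hb ε).comp (contDiff_const.prodMk contDiff_id)).differentiable
      (by simp) ξ
  have hl : HasDerivAt (fun t : ℝ => ξ + t • e) e 0 := by
    simpa using ((hasDerivAt_id (0 : ℝ)).smul_const e).const_add ξ
  have h0 : ξ + (0 : ℝ) • e = ξ := by simp
  have h1 := HasFDerivAt.comp_hasDerivAt (f := fun t : ℝ => ξ + t • e) 0
    (by rw [h0]; exact hd.hasFDerivAt) hl
  have h2 := hl.norm_sq.add ((hasDerivAt_symbolForm hb (hasDerivAt_const 0 x) hl).const_mul ε)
  have h3 := h1.unique h2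
  rw [h3]
  simp [e, EuclideanSpace.inner_single_right]

theorem fderiv_symbol_left {b : Fin n → Fin n → Eu n → ℝ} (hb : ∀ j k, ContDiff ℝ ∞ (b j k))
    (ε : ℝ) (x ξ : Eu n) (i : Fin n) :
    fderiv ℝ (fun y => ‖ξ‖ ^ 2 + ε * symbolForm b y ξ) x (EuclideanSpace.single i 1) =
      ε * symbolGradX b x ξ i := by
  set e : Eu n := EuclideanSpace.single i 1
  have hd : DifferentiableAt ℝ (fun y => ‖ξ‖ ^ 2 + ε * symbolForm b y ξ) x :=
    ((differentiable_symbol hb ε).comp (contDiff_id.prodMk contDiff_const)).differentiable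
      (by simp) x
  have hl : HasDerivAt (fun t : ℝ => x + t • e) e 0 := by
    simpa using ((hasDerivAt_id (0 : ℝ)).smul_const e).const_add x
  have h0 : x + (0 : ℝ) • e = x := by simp
  have h1 := HasFDerivAt.comp_hasDerivAt (f := fun t : ℝ => x + t • e) 0
    (by rw [h0]; exact hd.hasFDerivAt) hl
  have h2 := ((hasDerivAt_symbolForm hb hl (hasDerivAt_const 0 ξ)).const_mul ε).const_add
    (‖ξ‖ ^ 2)
  have h3 := h1.unique h2
  rw [h3]
  simp [e, EuclideanSpace.inner_single_right]

theorem norm_le_sum_abs (x : Eu n) : ‖x‖ ≤ ∑ i, |x i| := by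
  have hv : x = ∑ i, x i • EuclideanSpace.single i (1 : ℝ) := by
    ext j; simp [Pi.single_apply]
  conv_lhs => rw [hv]
  refine (norm_sum_le _ _).trans (Finset.sum_le_sum fun i _ => ?_)
  simp [norm_smul]

theorem abs_sum_fin_le {f : Fin n → ℝ} {M : ℝ} (h : ∀ k, |f k| ≤ M) : |∑ k, f k| ≤ n * M :=
  (Finset.abs_sum_le_sum_abs _ _).trans ((Finset.sum_le_sum fun k _ => h k).trans (by simp))

theorem abs_symbolForm_le {b : Fin n → Fin n → Eu n → ℝ} {x : Eu n} {β : ℝ}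
    (h : ∀ j k, |b j k x| ≤ β) (ξ : Eu n) : |symbolForm b x ξ| ≤ n * (n * (β * ‖ξ‖ ^ 2)) := by
  have h1 : ∀ j, |ξ j| ≤ ‖ξ‖ := fun j => PiLp.norm_apply_le ξ j
  have h2 : ∀ j k, |b j k x * ξ j * ξ k| ≤ β * ‖ξ‖ ^ 2 := by
    intro j k
    have hβ := (abs_nonneg _).trans (h j k)
    rw [abs_mul, abs_mul]
    calc _ ≤ β * ‖ξ‖ * ‖ξ‖ := by gcongr <;> simp [h, h1]
      _ = _ := by ring
  refine (Finset.abs_sum_le_sum_abs _ _).trans ?_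
  calc _ ≤ ∑ j : Fin n, (n * (β * ‖ξ‖ ^ 2)) := Finset.sum_le_sum fun j _ =>
        abs_sum_fin_le (h2 j)
    _ = _ := by simp

theorem norm_symbolGradX_le {b : Fin n → Fin n → Eu n → ℝ} {x : Eu n} {β : ℝ}
    (h : ∀ i j k, |pd i (b j k) x| ≤ β) (ξ : Eu n) :
    ‖symbolGradX b x ξ‖ ≤ n * (n * (n * (β * ‖ξ‖ ^ 2))) := by
  refine (norm_le_sum_abs _).trans ?_
  calc _ ≤ ∑ i : Fin n, (n * (n * (β * ‖ξ‖ ^ 2))) := Finset.sum_le_sum fun i _ =>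
        abs_symbolForm_le (b := fun j k => pd i (b j k)) (h i) ξ
    _ = _ := by simp

theorem norm_symbolGradXi_le {b : Fin n → Fin n → Eu n → ℝ} {x : Eu n} {β : ℝ}
    (h : ∀ j k, |b j k x| ≤ β) (ξ : Eu n) :
    ‖symbolGradXi b x ξ‖ ≤ n * (n * (2 * β * ‖ξ‖)) := by
  have h1 : ∀ j, |ξ j| ≤ ‖ξ‖ := fun j => PiLp.norm_apply_le ξ j
  refine (norm_le_sum_abs _).trans ?_
  have h2 : ∀ i k, |(b i k x + b k i x) * ξ k| ≤ 2 * β * ‖ξ‖ := by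
    intro i k
    rw [abs_mul]
    have h3 := (abs_nonneg _).trans (h i k)
    have h4 : |b i k x + b k i x| ≤ 2 * β := (abs_add_le _ _).trans (by linarith [h i k, h k i])
    exact mul_le_mul h4 (h1 k) (abs_nonneg _) (by linarith)
  calc ∑ i, |symbolGradXi b x ξ i| ≤ ∑ i : Fin n, (n * (2 * β * ‖ξ‖)) :=
        Finset.sum_le_sum fun i _ => abs_sum_fin_le (h2 i)
    _ = _ := by simp

theorem le_of_hasDerivAt_nonneg {f f' : ℝ → ℝ} (hf : ∀ t, HasDerivAt f (f' t) t)
    (h : ∀ t, 0 ≤ t → 0 ≤ f' t) (t : ℝ) (ht : 0 ≤ t) : f 0 ≤ f t := by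
  have : MonotoneOn f (Ici 0) :=
    monotoneOn_of_hasDerivWithinAt_nonneg (convex_Ici 0)
      (fun x _ => (hf x).continuousAt.continuousWithinAt)
      (fun x _ => (hf x).hasDerivWithinAt)
      (fun x hx => h x (interior_subset hx))
  exact this (by simp) ht ht

end Trajectories

section Nontrapping

variable {n : ℕ}

theorem energy_conservation {b : Fin n → Fin n → Eu n → ℝ} (hb : ∀ j k, ContDiff ℝ ∞ (b j k))
    {ε s : ℝ} {X Ξ : ℝ → Eu n}
    (hX : ∀ t, HasDerivAt X (s • ((2 : ℝ) • Ξ t + ε • symbolGradXi b (X t) (Ξ t))) t)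
    (hΞ : ∀ t, HasDerivAt Ξ (-(s * ε) • symbolGradX b (X t) (Ξ t)) t) (t : ℝ) :
    ‖Ξ t‖ ^ 2 + ε * symbolForm b (X t) (Ξ t) = ‖Ξ 0‖ ^ 2 + ε * symbolForm b (X 0) (Ξ 0) := by
  have h : ∀ t, HasDerivAt (fun t => ‖Ξ t‖ ^ 2 + ε * symbolForm b (X t) (Ξ t)) 0 t := by
    intro t
    refine ((hΞ t).norm_sq.add ((hasDerivAt_symbolForm hb (hX t) (hΞ t)).const_mul ε)).congr_deriv ?_
    simp only [inner_smul_right, inner_add_right]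
    rw [real_inner_comm (symbolGradX b (X t) (Ξ t)) (symbolGradXi b (X t) (Ξ t)),
      real_inner_comm (symbolGradX b (X t) (Ξ t)) (Ξ t)]
    ring
  exact is_const_of_deriv_eq_zero (fun t => (h t).differentiableAt) (fun t => (h t).deriv) t 0

/-- Trajectories starting in the outgoing region escape at linear speed. -/
theorem outgoing_lower_bound {b : Fin n → Fin n → Eu n → ℝ} (hb : ∀ j k, ContDiff ℝ ∞ (b j k))
    {ε c s : ℝ} (hε : 0 ≤ ε) (hc : ε * c ≤ 1 / 20) (hs : s * s = 1)
    (hq : ∀ x ξ, |symbolForm b x ξ| ≤ c * ‖ξ‖ ^ 2)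
    (hqx : ∀ x ξ, jb x * ‖symbolGradX b x ξ‖ ≤ c * ‖ξ‖ ^ 2)
    (hqξ : ∀ x ξ, jb x * ‖symbolGradXi b x ξ‖ ≤ c * ‖ξ‖) {X Ξ : ℝ → Eu n}
    (hX : ∀ t, HasDerivAt X (s • ((2 : ℝ) • Ξ t + ε • symbolGradXi b (X t) (Ξ t))) t)
    (hΞ : ∀ t, HasDerivAt Ξ (-(s * ε) • symbolGradX b (X t) (Ξ t)) t)
    (hout : -(1 / 4) * jb (X 0) * ‖Ξ 0‖ ≤ s * inner ℝ (X 0) (Ξ 0)) (h1 : 1 / 2 ≤ ‖Ξ 0‖)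
    (h2 : ‖Ξ 0‖ ≤ 2) (t : ℝ) (ht : 0 ≤ t) :
    (jb (X 0) + t) / 2 ≤ jb (X t) ∧ ‖Ξ t‖ ≤ 3 := by
  set e := ‖Ξ 0‖ with he
  set a := jb (X 0) with ha
  have ha1 : 1 ≤ a := one_le_jb _
  have hεc : ∀ t, ε * (c * ‖Ξ t‖ ^ 2) ≤ 1 / 20 * ‖Ξ t‖ ^ 2 := fun t => by
    nlinarith [sq_nonneg ‖Ξ t‖]
  have hN : ∀ t, ‖Ξ t‖ ^ 2 ≤ (21 / 19) * e ^ 2 ∧ (19 / 21) * e ^ 2 ≤ ‖Ξ t‖ ^ 2 := by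
    intro t
    have hE := energy_conservation hb hX hΞ t
    have b1 : |ε * symbolForm b (X t) (Ξ t)| ≤ 1 / 20 * ‖Ξ t‖ ^ 2 := by
      rw [abs_mul, abs_of_nonneg hε]
      exact (mul_le_mul_of_nonneg_left (hq _ _) hε).trans (hεc t)
    have b2 : |ε * symbolForm b (X 0) (Ξ 0)| ≤ 1 / 20 * e ^ 2 := by
      rw [abs_mul, abs_of_nonneg hε]
      exact (mul_le_mul_of_nonneg_left (hq _ _) hε).trans (hεc 0)
    rw [abs_le] at b1 b2
    constructor <;> linarith [b1.1, b1.2, b2.1, b2.2]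
  have hΞe : ∀ t, ‖Ξ t‖ ≤ (11 / 10) * e := fun t =>
    abs_le_of_sq_le_sq' (by nlinarith [(hN t).1, sq_nonneg e]) (by linarith) |>.2
  have hD : ∀ t, HasDerivAt (fun t => s * inner ℝ (X t) (Ξ t) - (1.7 * e ^ 2) * t)
      (2 * ‖Ξ t‖ ^ 2 + ε * inner ℝ (symbolGradXi b (X t) (Ξ t)) (Ξ t)
        - ε * inner ℝ (X t) (symbolGradX b (X t) (Ξ t)) - 1.7 * e ^ 2) t := by
    intro t
    have h := (((hX t).inner ℝ (hΞ t)).const_mul s).sub ((hasDerivAt_id t).const_mul (1.7 * e ^ 2))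
    refine h.congr_deriv ?_
    simp only [inner_smul_right, inner_smul_left, inner_add_left, real_inner_self_eq_norm_sq,
      conj_trivial]
    linear_combination (2 * ‖Ξ t‖ ^ 2 + ε * inner ℝ (symbolGradXi b (X t) (Ξ t)) (Ξ t)
      - ε * inner ℝ (X t) (symbolGradX b (X t) (Ξ t))) * hs
  have hD1 : ∀ t, 0 ≤ t → -(1 / 4) * a * e + 1.7 * e ^ 2 * t ≤ s * inner ℝ (X t) (Ξ t) := by
    intro t ht
    have h := le_of_hasDerivAt_nonneg hD (fun t _ => ?_) t ht
    · simp only [mul_zero, sub_zero] at h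
      linarith
    · have i1 : |inner ℝ (symbolGradXi b (X t) (Ξ t)) (Ξ t)| ≤ c * ‖Ξ t‖ ^ 2 := by
        refine (abs_real_inner_le_norm _ _).trans ?_
        have := hqξ (X t) (Ξ t)
        have h3 : ‖symbolGradXi b (X t) (Ξ t)‖ ≤ c * ‖Ξ t‖ :=
          (le_mul_of_one_le_left (norm_nonneg _) (one_le_jb _)).trans this
        nlinarith [norm_nonneg (Ξ t)]
      have i2 : |inner ℝ (X t) (symbolGradX b (X t) (Ξ t))| ≤ c * ‖Ξ t‖ ^ 2 :=
        (abs_real_inner_le_norm _ _).trans ((mul_le_mul_of_nonneg_right (norm_le_jb _)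
          (norm_nonneg _)).trans (hqx _ _))
      have j1 := mul_le_mul_of_nonneg_left (abs_le.1 i1).1 hε
      have j2 := mul_le_mul_of_nonneg_left (abs_le.1 i2).2 hε
      have := hεc t
      have := (hN t).2
      nlinarith [sq_nonneg e]
  have hR : ∀ t, HasDerivAt (fun t => ‖X t‖ ^ 2 + 1.11 * a * e * t - 3.4 * e ^ 2 * t ^ 2)
      (4 * (s * inner ℝ (X t) (Ξ t)) + 2 * (s * (ε * inner ℝ (X t) (symbolGradXi b (X t) (Ξ t))))
        + 1.11 * a * e - 6.8 * e ^ 2 * t) t := by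
    intro t
    have h := ((hX t).norm_sq.add ((hasDerivAt_id t).const_mul (1.11 * a * e))).sub
      ((hasDerivAt_pow 2 t).const_mul (3.4 * e ^ 2))
    refine h.congr_deriv ?_
    simp only [inner_smul_right, inner_add_right]
    norm_num
    ring
  have hR1 : ∀ t, 0 ≤ t → ‖X 0‖ ^ 2 ≤ ‖X t‖ ^ 2 + 1.11 * a * e * t - 3.4 * e ^ 2 * t ^ 2 := by
    intro t ht
    have h := le_of_hasDerivAt_nonneg hR (fun t ht => ?_) t ht
    · simpa using h
    · have i1 : |s * (ε * inner ℝ (X t) (symbolGradXi b (X t) (Ξ t)))| ≤ 0.055 * e := by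
        have hs1 : |s| = 1 := by
          rcases mul_self_eq_one_iff.1 hs with h | h <;> simp [h]
        rw [abs_mul, hs1, one_mul, abs_mul, abs_of_nonneg hε]
        have h3 : |inner ℝ (X t) (symbolGradXi b (X t) (Ξ t))| ≤ c * ‖Ξ t‖ :=
          (abs_real_inner_le_norm _ _).trans ((mul_le_mul_of_nonneg_right (norm_le_jb _)
            (norm_nonneg _)).trans (hqξ _ _))
        have h4 := mul_le_mul_of_nonneg_left h3 hε
        nlinarith [hΞe t, norm_nonneg (Ξ t)]
      have := hD1 t ht
      have := (abs_le.1 i1).1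
      nlinarith
  refine ⟨?_, by linarith [hΞe t]⟩
  have h3 := hR1 t ht
  have h4 := jb_sq (X t)
  have h5 := jb_sq (X 0)
  have h6 : 0 ≤ jb (X t) := zero_le_one.trans (one_le_jb _)
  refine abs_le_of_sq_le_sq' ?_ h6 |>.2
  have h7 : t ≤ 2 * (e * t) := by nlinarith
  have h8 : (a + t) ^ 2 ≤ (a + 2 * (e * t)) ^ 2 := by gcongr
  nlinarith [sq_nonneg (a - 1.4 * (e * t)), sq_nonneg (e * t), sq_nonneg a]

end Nontrapping

section Field

variable {n : ℕ}

theorem JetBound.const_smul {V W : Type*} [NormedAddCommGroup V] [NormedSpace ℝ V]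
    [NormedAddCommGroup W] [NormedSpace ℝ W] {f : V → W} {x : V} {C : ℕ → ℝ} {r : ℝ}
    (hf : JetBound f x C r) (c : ℝ) : JetBound (fun v => c • f v) x C (|c| * r) := by
  refine ⟨hf.1.const_smul c, fun m => ?_⟩
  have h : iteratedFDeriv ℝ m (fun v => c • f v) x = c • iteratedFDeriv ℝ m f x :=
    iteratedFDeriv_const_smul_apply (hf.1.contDiffAt.of_le (by exact_mod_cast le_top))
  rw [h, norm_smul, Real.norm_eq_abs]
  calc _ ≤ |c| * (C m * r) := by gcongr; exact hf.2 m
    _ = _ := by ring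

/-- Derivatives of a symbol-type coefficient composed with a linear map whose size matches the
size of its value. -/
theorem jetBound_comp_of_decay {V : Type*} [NormedAddCommGroup V] [NormedSpace ℝ V]
    {c : Eu n → ℝ} (hc : ContDiff ℝ ∞ c) {D : ℕ → ℝ} {κ : ℝ} (hκ : 0 ≤ κ) (hD : ∀ m, 0 ≤ D m)
    (h : ∀ (m : ℕ) x, ‖iteratedFDeriv ℝ m c x‖ ≤ D m * jb x ^ (-(κ + m))) {T : V →L[ℝ] Eu n}
    {v : V} {l : ℝ} (hl : 0 < l) (hT : ‖T‖ ≤ 4 * l) (hv : l / 2 ≤ jb (T v)) :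
    JetBound (fun v => c (T v)) v (fun m => D m * 2 ^ (κ + m) * 4 ^ m) (l ^ (-κ)) := by
  refine ⟨hc.comp T.contDiff, fun m => ?_⟩
  refine (norm_iteratedFDeriv_comp_clm_le hc T v m).trans ?_
  have h1 : jb (T v) ^ (-(κ + m)) ≤ (l / 2) ^ (-(κ + m)) :=
    Real.rpow_le_rpow_of_nonpos (by positivity) hv (by linarith [(Nat.cast_nonneg m : (0:ℝ) ≤ m)])
  have h2 : (l / 2) ^ (-(κ + m)) * (4 * l) ^ m = 2 ^ (κ + m) * 4 ^ m * l ^ (-κ) := by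
    rw [Real.div_rpow hl.le (by norm_num), Real.rpow_neg (by norm_num : (0:ℝ) ≤ 2), div_inv_eq_mul,
      neg_add, Real.rpow_add hl, Real.rpow_neg hl.le (m : ℝ), Real.rpow_natCast, mul_pow]
    field_simp
  calc _ ≤ (D m * (l / 2) ^ (-(κ + m))) * (4 * l) ^ m := by
        have h3 := (h m _).trans (mul_le_mul_of_nonneg_left h1 (hD m))
        gcongr
        exact (norm_nonneg _).trans h3
    _ = D m * ((l / 2) ^ (-(κ + m)) * (4 * l) ^ m) := by ring
    _ = _ := by rw [h2]; ring

theorem jetBound_coordinate {V : Type*} [NormedAddCommGroup V] [NormedSpace ℝ V]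
    {T : V →L[ℝ] Eu n} {v : V} (hT : ‖T‖ ≤ 3) (hv : ‖T v‖ ≤ 3) (i : Fin n) :
    JetBound (fun v => T v i) v (fun _ => 3) 1 := by
  have h := jetBound_affine (0 : ℝ) ((EuclideanSpace.proj i : Eu n →L[ℝ] ℝ).comp T) v (B := 3)
    (by simpa using (PiLp.norm_apply_le (T v) i).trans hv)
    ((ContinuousLinearMap.opNorm_comp_le _ _).trans
      ((mul_le_of_le_one_left (norm_nonneg _) (norm_euclideanProj_le i)).trans hT))
  simpa using h

theorem exists_jetBound_of_apply (n : ℕ) (C : Fin n → ℕ → ℝ) : ∃ D : ℕ → ℝ,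
    ∀ (V : Type) [NormedAddCommGroup V] [NormedSpace ℝ V] (f : V → Eu n) (v : V) (r : ℝ),
      (∀ i, JetBound (fun v => f v i) v (C i) r) → JetBound f v D r := by
  refine ⟨fun m => ∑ i, ‖ContinuousLinearMap.toSpanSingleton ℝ
    (EuclideanSpace.single i (1 : ℝ) : Eu n)‖ * C i m, fun V _ _ f v r h => ?_⟩
  have h1 := JetBound.sum (s := Finset.univ) fun i _ => (h i).comp_clm_left
    (ContinuousLinearMap.toSpanSingleton ℝ (EuclideanSpace.single i (1 : ℝ) : Eu n))
  have h2 : f = fun v => ∑ i, ContinuousLinearMap.toSpanSingleton ℝ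
      (EuclideanSpace.single i (1 : ℝ) : Eu n) (f v i) := by
    funext v
    ext j
    simp [Pi.single_apply]
  rw [h2]
  exact h1

theorem exists_jetBound_symbolGradX (n : ℕ) (κ : ℝ) (hκ : 0 ≤ κ) (D : ℕ → ℝ) (hD : ∀ m, 0 ≤ D m) :
    ∃ C : ℕ → ℝ, ∀ (V : Type) [NormedAddCommGroup V] [NormedSpace ℝ V]
      (b : Fin n → Fin n → Eu n → ℝ), (∀ j k, ContDiff ℝ ∞ (b j k)) →
      (∀ i j k (m : ℕ) x, ‖iteratedFDeriv ℝ m (pd i (b j k)) x‖ ≤ D m * jb x ^ (-(κ + m))) →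
      ∀ (S T : V →L[ℝ] Eu n) (v : V) (l : ℝ), 0 < l → ‖S‖ ≤ 4 * l → l / 2 ≤ jb (S v) → ‖T‖ ≤ 3 →
      ‖T v‖ ≤ 3 → JetBound (fun v => symbolGradX b (S v) (T v)) v C (l ^ (-κ)) := by
  obtain ⟨C, hC⟩ := exists_jetBound_of_apply n fun _ => _
  refine ⟨C, fun V _ _ b hb hbD S T v l hl hS hSv hT hTv => hC V _ v _ fun i => ?_⟩
  have h := JetBound.sum (s := Finset.univ) fun j _ => JetBound.sum (s := Finset.univ) fun k _ =>
    ((jetBound_comp_of_decay (contDiff_fderiv_apply_const (hb j k) (EuclideanSpace.single i 1)) hκ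
      hD (hbD i j k) hl hS hSv).mul (jetBound_coordinate hT hTv j)).mul
      (jetBound_coordinate hT hTv k)
  simp only [mul_one] at h
  exact h

theorem exists_jetBound_symbolGradXi (n : ℕ) (κ : ℝ) (hκ : 0 ≤ κ) (D : ℕ → ℝ) (hD : ∀ m, 0 ≤ D m) :
    ∃ C : ℕ → ℝ, ∀ (V : Type) [NormedAddCommGroup V] [NormedSpace ℝ V]
      (b : Fin n → Fin n → Eu n → ℝ), (∀ j k, ContDiff ℝ ∞ (b j k)) →
      (∀ j k (m : ℕ) x, ‖iteratedFDeriv ℝ m (b j k) x‖ ≤ D m * jb x ^ (-(κ + m))) →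
      ∀ (S T : V →L[ℝ] Eu n) (v : V) (l : ℝ), 0 < l → ‖S‖ ≤ 4 * l → l / 2 ≤ jb (S v) → ‖T‖ ≤ 3 →
      ‖T v‖ ≤ 3 → JetBound (fun v => symbolGradXi b (S v) (T v)) v C (l ^ (-κ)) := by
  obtain ⟨C, hC⟩ := exists_jetBound_of_apply n fun _ => _
  refine ⟨C, fun V _ _ b hb hbD S T v l hl hS hSv hT hTv => hC V _ v _ fun i => ?_⟩
  have h := JetBound.sum (s := Finset.univ) fun j _ =>
    ((jetBound_comp_of_decay (hb i j) hκ hD (hbD i j) hl hS hSv).add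
      (jetBound_comp_of_decay (hb j i) hκ hD (hbD j i) hl hS hSv)).mul
      (jetBound_coordinate hT hTv j)
  simp only [mul_one] at h
  exact h

/-- Position as a function of the rescaled initial data and of the rescaled unknowns. -/
def positionMap (n : ℕ) (s a t : ℝ) : (Eu n × Eu n) × (Eu n × Eu n) →L[ℝ] Eu n :=
  a • (ContinuousLinearMap.fst ℝ (Eu n) (Eu n)).comp (ContinuousLinearMap.fst ℝ _ _) +
    a • (ContinuousLinearMap.fst ℝ (Eu n) (Eu n)).comp (ContinuousLinearMap.snd ℝ _ _) +
    (2 * (s * t)) • ((ContinuousLinearMap.snd ℝ (Eu n) (Eu n)).comp (ContinuousLinearMap.fst ℝ _ _) +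
      (ContinuousLinearMap.snd ℝ (Eu n) (Eu n)).comp (ContinuousLinearMap.snd ℝ _ _))

/-- Momentum as a function of the rescaled initial data and of the rescaled unknowns. -/
def momentumMap (n : ℕ) : (Eu n × Eu n) × (Eu n × Eu n) →L[ℝ] Eu n :=
  (ContinuousLinearMap.snd ℝ (Eu n) (Eu n)).comp (ContinuousLinearMap.fst ℝ _ _) +
    (ContinuousLinearMap.snd ℝ (Eu n) (Eu n)).comp (ContinuousLinearMap.snd ℝ _ _)

theorem positionMap_apply (s a t : ℝ) (v : (Eu n × Eu n) × (Eu n × Eu n)) :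
    positionMap n s a t v =
      a • v.1.1 + a • v.2.1 + (2 * (s * t)) • (v.1.2 + v.2.2) := rfl

theorem momentumMap_apply (v : (Eu n × Eu n) × (Eu n × Eu n)) :
    momentumMap n v = v.1.2 + v.2.2 := rfl

theorem norm_momentumMap_le : ‖momentumMap n‖ ≤ 3 := by
  refine ContinuousLinearMap.opNorm_le_bound _ (by norm_num) fun v => ?_
  rw [momentumMap_apply]
  have h1 : ‖v.1.2‖ ≤ ‖v‖ := (norm_snd_le _).trans (norm_fst_le _)
  have h2 : ‖v.2.2‖ ≤ ‖v‖ := (norm_snd_le _).trans (norm_snd_le _)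
  linarith [norm_add_le v.1.2 v.2.2, norm_nonneg v]

theorem abs_eq_one_of_mul_self {s : ℝ} (hs : s * s = 1) : |s| = 1 := by
  rcases mul_self_eq_one_iff.1 hs with h | h <;> simp [h]

theorem norm_positionMap_le {s a t : ℝ} (hs : s * s = 1) (ha : 1 ≤ a) (ht : 0 ≤ t) :
    ‖positionMap n s a t‖ ≤ 4 * (a + t) := by
  refine ContinuousLinearMap.opNorm_le_bound _ (by linarith) fun v => ?_
  rw [positionMap_apply]
  have h0 : ‖v.1.1‖ ≤ ‖v‖ := (norm_fst_le _).trans (norm_fst_le _)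
  have h0' : ‖v.2.1‖ ≤ ‖v‖ := (norm_fst_le _).trans (norm_snd_le _)
  have h1 : ‖v.1.2‖ ≤ ‖v‖ := (norm_snd_le _).trans (norm_fst_le _)
  have h2 : ‖v.2.2‖ ≤ ‖v‖ := (norm_snd_le _).trans (norm_snd_le _)
  have h3 : ‖(2 * (s * t)) • (v.1.2 + v.2.2)‖ ≤ 2 * t * (2 * ‖v‖) := by
    rw [norm_smul, Real.norm_eq_abs, abs_mul, abs_mul, abs_eq_one_of_mul_self hs, abs_of_nonneg ht,
      one_mul, abs_two]
    gcongr
    linarith [norm_add_le v.1.2 v.2.2]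
  have h4 : ‖a • v.1.1 + a • v.2.1‖ ≤ a * (2 * ‖v‖) := by
    rw [← smul_add, norm_smul, Real.norm_eq_abs, abs_of_nonneg (by linarith)]
    gcongr
    linarith [norm_add_le v.1.1 v.2.1]
  nlinarith [norm_add_le (a • v.1.1 + a • v.2.1) ((2 * (s * t)) • (v.1.2 + v.2.2)), norm_nonneg v]

/-- The vector field governing the rescaled deviations from free motion. -/
def deviationField (b : Fin n → Fin n → Eu n → ℝ) (ε s a t : ℝ)
    (v : (Eu n × Eu n) × (Eu n × Eu n)) : Eu n × Eu n :=
  ((s * ε / a) • (symbolGradXi b (positionMap n s a t v) (momentumMap n v) +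
      (2 * (s * t)) • symbolGradX b (positionMap n s a t v) (momentumMap n v)),
    (-(s * ε)) • symbolGradX b (positionMap n s a t v) (momentumMap n v))

theorem contDiff_symbolGradX {b : Fin n → Fin n → Eu n → ℝ} (hb : ∀ j k, ContDiff ℝ ∞ (b j k)) :
    ContDiff ℝ ∞ fun v : Eu n × Eu n => symbolGradX b v.1 v.2 := by
  have h1 : ∀ j, ContDiff ℝ ∞ (fun v : Eu n × Eu n => v.2 j) := fun j =>
    (EuclideanSpace.proj j : Eu n →L[ℝ] ℝ).contDiff.comp contDiff_snd
  refine contDiff_euclidean.2 fun i => ?_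
  change ContDiff ℝ ∞ fun v : Eu n × Eu n => ∑ j, ∑ k, pd i (b j k) v.1 * v.2 j * v.2 k
  exact ContDiff.sum fun j _ => ContDiff.sum fun k _ =>
    (((contDiff_fderiv_apply_const (hb j k) _).comp contDiff_fst).mul (h1 j)).mul (h1 k)

theorem contDiff_symbolGradXi {b : Fin n → Fin n → Eu n → ℝ} (hb : ∀ j k, ContDiff ℝ ∞ (b j k)) :
    ContDiff ℝ ∞ fun v : Eu n × Eu n => symbolGradXi b v.1 v.2 := by
  have h1 : ∀ j, ContDiff ℝ ∞ (fun v : Eu n × Eu n => v.2 j) := fun j =>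
    (EuclideanSpace.proj j : Eu n →L[ℝ] ℝ).contDiff.comp contDiff_snd
  refine contDiff_euclidean.2 fun i => ?_
  change ContDiff ℝ ∞ fun v : Eu n × Eu n => ∑ j, (b i j v.1 + b j i v.1) * v.2 j
  exact ContDiff.sum fun j _ =>
    (((hb i j).comp contDiff_fst).add ((hb j i).comp contDiff_fst)).mul (h1 j)

theorem contDiff_deviationField {b : Fin n → Fin n → Eu n → ℝ} (hb : ∀ j k, ContDiff ℝ ∞ (b j k))
    (ε s a t : ℝ) : ContDiff ℝ ∞ (deviationField b ε s a t) := by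
  have h : ContDiff ℝ ∞ fun v => (positionMap n s a t v, momentumMap n v) :=
    (positionMap n s a t).contDiff.prodMk (momentumMap n).contDiff
  have h1 := (contDiff_symbolGradX hb).comp h
  have h2 := (contDiff_symbolGradXi hb).comp h
  exact ((h2.add (h1.const_smul _)).const_smul _).prodMk (h1.const_smul _)

theorem exists_jetBound_deviationField (n : ℕ) {σ : ℝ} (hσ : 0 < σ) (A : ℕ → ℝ)
    (hA : ∀ ℓ, 0 < A ℓ) : ∃ C : ℕ → ℝ, ∀ b : Fin n → Fin n → Eu n → ℝ,
      (∀ j k, ContDiff ℝ ∞ (b j k)) →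
      (∀ j k (m : ℕ) x, ‖iteratedFDeriv ℝ m (b j k) x‖ ≤
        (n : ℝ) ^ m * (A m * jb x ^ (-(1 + (m : ℝ) + σ)))) →
      ∀ ε s a t : ℝ, 0 < ε → s * s = 1 → 1 ≤ a → 0 ≤ t → ∀ v, (a + t) / 2 ≤ jb (positionMap n s a t v) →
        ‖momentumMap n v‖ ≤ 3 →
        JetBound (deviationField b ε s a t) v C (ε / a * (a + t) ^ (-(1 + σ))) := by
  obtain ⟨C₁, hC₁⟩ := exists_jetBound_symbolGradXi n (1 + σ) (by linarith) (fun m => n ^ m * A m)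
    (fun m => by have := hA m; positivity)
  obtain ⟨C₂, hC₂⟩ := exists_jetBound_symbolGradX n (2 + σ) (by linarith)
    (fun m => n ^ (m + 1) * A (m + 1)) (fun m => by have := hA (m + 1); positivity)
  refine ⟨fun m => ‖ContinuousLinearMap.inl ℝ (Eu n) (Eu n)‖ * (C₁ m + 2 * C₂ m) +
    ‖ContinuousLinearMap.inr ℝ (Eu n) (Eu n)‖ * C₂ m, fun b hb hbA ε s a t hε hs ha ht v hp hm => ?_⟩
  have hl : 0 < a + t := by linarith
  have h1 := hC₁ _ b hb (fun j k m x => (hbA j k m x).trans_eq (by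
    rw [show 1 + (m : ℝ) + σ = 1 + σ + m by ring]; ring)) _ _ v _ hl (norm_positionMap_le hs ha ht)
    hp norm_momentumMap_le hm
  have h2 := hC₂ _ b hb (fun i j k m x => by
    have e : ‖iteratedFDeriv ℝ m (pd i (b j k)) x‖ ≤ ‖iteratedFDeriv ℝ (m + 1) (b j k) x‖ := by
      rw [← norm_iteratedFDeriv_fderiv]
      have := (ContinuousLinearMap.apply ℝ ℝ
        (EuclideanSpace.single i (1 : ℝ) : Eu n)).norm_iteratedFDeriv_comp_left (n := m) (x := x)
        (((hb j k).fderiv_right (m := ∞) (by simp)).contDiffAt (x := x)) (by exact_mod_cast le_top)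
      refine this.trans (mul_le_of_le_one_left (norm_nonneg _) ?_)
      refine ContinuousLinearMap.opNorm_le_bound _ zero_le_one fun T => ?_
      simpa using T.le_opNorm (EuclideanSpace.single i (1 : ℝ))
    refine e.trans ((hbA j k (m + 1) x).trans_eq ?_)
    push_cast
    rw [show 1 + ((m : ℝ) + 1) + σ = 2 + σ + m by ring]; ring) _ _ v _ hl
    (norm_positionMap_le hs ha ht) hp norm_momentumMap_le hm
  have hs1 := abs_eq_one_of_mul_self hs
  have hpow : (a + t) ^ (-(1 + σ)) = (a + t) * (a + t) ^ (-(2 + σ)) := by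
    rw [show -(1 + σ) = 1 + -(2 + σ) by ring, Real.rpow_add hl, Real.rpow_one]
  have hq : 0 < (a + t) ^ (-(2 + σ)) := Real.rpow_pos_of_pos hl _
  have h3 : JetBound (fun v => (2 : ℝ) • ((s * t) • symbolGradX b (positionMap n s a t v)
      (momentumMap n v))) v (fun m => 2 * C₂ m) ((a + t) ^ (-(1 + σ))) := by
    refine ((h2.const_smul (s * t)).const_smul 2).congr fun m => ?_
    rw [abs_mul, hs1, abs_of_nonneg ht, abs_two, hpow]
    have hc : 0 ≤ C₂ m := nonneg_of_mul_nonneg_left ((norm_nonneg _).trans (h2.2 m)) hq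
    have : 0 ≤ C₂ m * (a + t) ^ (-(2 + σ)) := by positivity
    nlinarith
  have h4 := (h1.add h3).const_smul (s * ε / a)
  have h5 : JetBound (fun v => (-(s * ε)) • symbolGradX b (positionMap n s a t v)
      (momentumMap n v)) v C₂ (ε / a * (a + t) ^ (-(1 + σ))) := by
    refine (h2.const_smul (-(s * ε))).congr fun m => ?_
    rw [abs_neg, abs_mul, hs1, abs_of_pos hε, hpow]
    have hc : 0 ≤ C₂ m := nonneg_of_mul_nonneg_left ((norm_nonneg _).trans (h2.2 m)) hq
    have h6 : 1 ≤ (a + t) / a := (one_le_div (by linarith)).2 (by linarith)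
    have h7 : 0 ≤ C₂ m * ε * (a + t) ^ (-(2 + σ)) := by positivity
    calc _ = C₂ m * ε * (a + t) ^ (-(2 + σ)) := by ring
      _ ≤ C₂ m * ε * (a + t) ^ (-(2 + σ)) * ((a + t) / a) := le_mul_of_one_le_right h7 h6
      _ = _ := by ring
  have e4 : |s * ε / a| * (a + t) ^ (-(1 + σ)) = ε / a * (a + t) ^ (-(1 + σ)) := by
    rw [abs_div, abs_mul, hs1, abs_of_pos hε, abs_of_pos (by linarith : 0 < a), one_mul]
  rw [e4] at h4
  have h6 := (h4.comp_clm_left (ContinuousLinearMap.inl ℝ (Eu n) (Eu n))).add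
    (h5.comp_clm_left (ContinuousLinearMap.inr ℝ (Eu n) (Eu n)))
  convert h6 using 1
  funext v
  simp [deviationField, mul_smul]

end Field

section Deviation

variable {n : ℕ}

/-- The primitive of `t ↦ (ε/a) (a+t)^{-1-σ}` vanishing at `0`. -/
def decayPrimitive (ε σ a t : ℝ) : ℝ := ε / (a * σ) * (a ^ (-σ) - (a + t) ^ (-σ))

theorem hasDerivAt_decayPrimitive {ε σ a t : ℝ} (hσ : 0 < σ) (ha : 1 ≤ a) (ht : 0 ≤ t) :
    HasDerivAt (decayPrimitive ε σ a) (ε / a * (a + t) ^ (-(1 + σ))) t := by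
  have h1 : HasDerivAt (fun t => (a + t) ^ (-σ)) _ t :=
    ((hasDerivAt_id t).const_add a).rpow_const (p := -σ) (Or.inl (by simp only [id]; positivity))
  have h2 := (h1.const_sub (a ^ (-σ))).const_mul (ε / (a * σ))
  refine h2.congr_deriv ?_
  have : -σ - 1 = -(1 + σ) := by ring
  simp only [id, this]
  field_simp

theorem decayPrimitive_nonneg {ε σ a t : ℝ} (hε : 0 < ε) (hσ : 0 < σ) (ha : 1 ≤ a) (ht : 0 ≤ t) :
    0 ≤ decayPrimitive ε σ a t := by
  have : (a + t) ^ (-σ) ≤ a ^ (-σ) :=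
    Real.rpow_le_rpow_of_nonpos (by linarith) (by linarith) (by linarith)
  exact mul_nonneg (by positivity) (by linarith)

theorem decayPrimitive_le {ε σ a t : ℝ} (hε : 0 < ε) (hσ : 0 < σ) (ha : 1 ≤ a) (ht : 0 ≤ t) :
    decayPrimitive ε σ a t ≤ ε / σ * a ^ (-(1 + σ)) := by
  have h1 : 0 ≤ (a + t) ^ (-σ) := Real.rpow_nonneg (by linarith) _
  have ha0 : 0 < a := by linarith
  have h2 : a ^ (-(1 + σ)) = a⁻¹ * a ^ (-σ) := by
    rw [neg_add, Real.rpow_add ha0, Real.rpow_neg_one]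
  rw [h2, decayPrimitive]
  calc _ ≤ ε / (a * σ) * a ^ (-σ) := by gcongr; linarith
    _ = _ := by field_simp

/-- The rescaled deviations of the flow from free motion. -/
def scaledDeviation (Xf Ξf : ℝ → Eu n → Eu n → Eu n) (s a : ℝ) (q : ℝ × Eu n × Eu n) : Eu n × Eu n :=
  (a⁻¹ • (Xf (s * q.1) (a • q.2.1) q.2.2 - a • q.2.1
      - (2 * (s * q.1)) • Ξf (s * q.1) (a • q.2.1) q.2.2),
    Ξf (s * q.1) (a • q.2.1) q.2.2 - q.2.2)

theorem contDiff_scaledDeviation {Xf Ξf : ℝ → Eu n → Eu n → Eu n}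
    (hf : ContDiff ℝ ∞ fun q : ℝ × Eu n × Eu n => (Xf q.1 q.2.1 q.2.2, Ξf q.1 q.2.1 q.2.2))
    (s a : ℝ) : ContDiff ℝ ∞ (scaledDeviation Xf Ξf s a) := by
  have hs : ContDiff ℝ ∞ fun q : ℝ × Eu n × Eu n => (s * q.1, a • q.2.1, q.2.2) := by fun_prop
  have h1 : ContDiff ℝ ∞ fun q : ℝ × Eu n × Eu n => Xf (s * q.1) (a • q.2.1) q.2.2 :=
    (contDiff_fst.comp hf).comp hs
  have h2 : ContDiff ℝ ∞ fun q : ℝ × Eu n × Eu n => Ξf (s * q.1) (a • q.2.1) q.2.2 :=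
    (contDiff_snd.comp hf).comp hs
  have h3 : ContDiff ℝ ∞ fun q : ℝ × Eu n × Eu n => a • q.2.1 := by fun_prop
  have h4 : ContDiff ℝ ∞ fun q : ℝ × Eu n × Eu n => 2 * (s * q.1) := by fun_prop
  exact (((h1.sub h3).sub (h4.smul h2)).const_smul a⁻¹).prodMk (h2.sub (by fun_prop))

theorem positionMap_scaledDeviation (Xf Ξf : ℝ → Eu n → Eu n → Eu n) (s : ℝ) {a : ℝ} (ha : a ≠ 0)
    (t : ℝ) (w : Eu n × Eu n) :
    positionMap n s a t (w, scaledDeviation Xf Ξf s a (t, w)) = Xf (s * t) (a • w.1) w.2 := by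
  simp only [positionMap_apply, scaledDeviation, smul_inv_smul₀ ha]
  module

theorem momentumMap_scaledDeviation (Xf Ξf : ℝ → Eu n → Eu n → Eu n) (s a t : ℝ)
    (w : Eu n × Eu n) :
    momentumMap n (w, scaledDeviation Xf Ξf s a (t, w)) = Ξf (s * t) (a • w.1) w.2 := by
  simp [momentumMap_apply, scaledDeviation]

theorem fderiv_scaledDeviation {b : Fin n → Fin n → Eu n → ℝ} {ε s a : ℝ}
    (ha : a ≠ 0) {Xf Ξf : ℝ → Eu n → Eu n → Eu n}
    (hf : ContDiff ℝ ∞ fun q : ℝ × Eu n × Eu n => (Xf q.1 q.2.1 q.2.2, Ξf q.1 q.2.1 q.2.2))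
    (hX : ∀ x ξ t, HasDerivAt (fun t => Xf (s * t) x ξ) (s • ((2 : ℝ) • Ξf (s * t) x ξ +
      ε • symbolGradXi b (Xf (s * t) x ξ) (Ξf (s * t) x ξ))) t)
    (hΞ : ∀ x ξ t, HasDerivAt (fun t => Ξf (s * t) x ξ)
      (-(s * ε) • symbolGradX b (Xf (s * t) x ξ) (Ξf (s * t) x ξ)) t) (t : ℝ) (w : Eu n × Eu n) :
    fderiv ℝ (scaledDeviation Xf Ξf s a) (t, w) (1, 0) =
      deviationField b ε s a t (w, scaledDeviation Xf Ξf s a (t, w)) := by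
  refine (hasDerivAt_slice (contDiff_scaledDeviation hf s a) t w).unique ?_
  have hX := hX (a • w.1) w.2 t
  have hΞ := hΞ (a • w.1) w.2 t
  have hl : HasDerivAt (fun t : ℝ => 2 * (s * t)) (2 * s) t := by
    simpa using ((hasDerivAt_id t).const_mul s).const_mul 2
  have h := (((hX.sub_const (a • w.1)).fun_sub (hl.fun_smul hΞ)).fun_const_smul a⁻¹).prodMk
    (hΞ.sub_const w.2)
  refine h.congr_deriv ?_
  rw [deviationField, positionMap_scaledDeviation Xf Ξf s ha, momentumMap_scaledDeviation]
  refine Prod.ext ?_ rfl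
  simp only [smul_sub, smul_add, smul_smul]
  match_scalars
  · ring
  · ring
  · field_simp

theorem exists_foldr_deviation_bound (n : ℕ) {σ : ℝ} (hσ : 0 < σ) (A : ℕ → ℝ)
    (hA : ∀ ℓ, 0 < A ℓ) (k : ℕ) : ∃ M : ℝ, 0 < M ∧ ∀ b : Fin n → Fin n → Eu n → ℝ,
      (∀ j k, ContDiff ℝ ∞ (b j k)) →
      (∀ j k (m : ℕ) x, ‖iteratedFDeriv ℝ m (b j k) x‖ ≤
        (n : ℝ) ^ m * (A m * jb x ^ (-(1 + (m : ℝ) + σ)))) →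
      ∀ ε s c : ℝ, 0 < ε → ε ≤ 1 → s * s = 1 → ε * c ≤ 1 / 20 →
      (∀ x ξ, |symbolForm b x ξ| ≤ c * ‖ξ‖ ^ 2) →
      (∀ x ξ, jb x * ‖symbolGradX b x ξ‖ ≤ c * ‖ξ‖ ^ 2) →
      (∀ x ξ, jb x * ‖symbolGradXi b x ξ‖ ≤ c * ‖ξ‖) →
      ∀ Xf Ξf : ℝ → Eu n → Eu n → Eu n,
      ContDiff ℝ ∞ (fun q : ℝ × Eu n × Eu n => (Xf q.1 q.2.1 q.2.2, Ξf q.1 q.2.1 q.2.2)) →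
      (∀ x ξ t, HasDerivAt (fun t => Xf (s * t) x ξ) (s • ((2 : ℝ) • Ξf (s * t) x ξ +
        ε • symbolGradXi b (Xf (s * t) x ξ) (Ξf (s * t) x ξ))) t) →
      (∀ x ξ t, HasDerivAt (fun t => Ξf (s * t) x ξ)
        (-(s * ε) • symbolGradX b (Xf (s * t) x ξ) (Ξf (s * t) x ξ)) t) →
      (∀ x ξ, Xf 0 x ξ = x) → (∀ x ξ, Ξf 0 x ξ = ξ) →
      ∀ LA LB : List (Fin n), LA.length + LB.length = k →
      ∀ x ξ : Eu n, 1 / 2 ≤ ‖ξ‖ → ‖ξ‖ ≤ 2 → -(1 / 4) * jb x * ‖ξ‖ ≤ s * inner ℝ x ξ →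
      ∀ t : ℝ, 0 ≤ t → ∀ j : Fin n,
        |LA.foldr pdX (LB.foldr pdXi
          fun y η => Xf (s * t) y η j - y j - 2 * (s * t) * Ξf (s * t) y η j) x ξ| ≤
            ε * M * jb x ^ (-((LA.length : ℝ) + σ)) ∧
        |LA.foldr pdX (LB.foldr pdXi fun y η => Ξf (s * t) y η j - η j) x ξ| ≤
            ε * M * jb x ^ (-(1 + (LA.length : ℝ) + σ)) := by
  obtain ⟨C, hC⟩ := exists_jetBound_deviationField n hσ A hA
  obtain ⟨K, hK, hmain⟩ := exists_dirDeriv_bound (P := Eu n × Eu n) k C (1 / σ)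
  refine ⟨K / σ, by positivity, ?_⟩
  intro b hb hbA ε s c hε hε1 hs hc hq hqx hqξ Xf Ξf hf hX hΞ hX0 hΞ0 LA LB hL x ξ hξ1 hξ2 hout
    t ht j
  set a := jb x with ha
  have ha1 : 1 ≤ a := one_le_jb x
  have ha0 : 0 < a := by linarith
  set G := scaledDeviation Xf Ξf s a with hG
  have hGs : ContDiff ℝ ∞ G := contDiff_scaledDeviation hf s a
  set w₀ : Eu n × Eu n := (a⁻¹ • x, ξ) with hw
  have hx : a • w₀.1 = x := smul_inv_smul₀ ha0.ne' x
  set L : List (Eu n × Eu n) := (LA.map fun i => ((EuclideanSpace.single i (1 : ℝ) : Eu n), (0 : Eu n))) ++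
        (LB.map fun i => ((0 : Eu n), (EuclideanSpace.single i (1 : ℝ) : Eu n))) with hLdef
  have hray : ∀ t, 0 ≤ t → (a + t) / 2 ≤ jb (Xf (s * t) x ξ) ∧ ‖Ξf (s * t) x ξ‖ ≤ 3 := by
    intro t ht
    have h := outgoing_lower_bound hb hε.le hc hs hq hqx hqξ (X := fun t => Xf (s * t) x ξ)
      (Ξ := fun t => Ξf (s * t) x ξ) (hX x ξ) (hΞ x ξ)
    simp only [mul_zero, hX0, hΞ0] at h
    exact h hout hξ1 hξ2 t ht
  have hr : decayPrimitive ε σ a t ≤ ε / σ * a ^ (-(1 + σ)) := decayPrimitive_le hε hσ ha1 ht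
  have hbound : ‖dirDeriv (L.map fun h => ((0 : ℝ), h)) G (t, w₀)‖ ≤
      K * decayPrimitive ε σ a t := by
    refine hmain _ G (deviationField b ε s a) w₀ (decayPrimitive ε σ a)
      (fun t => ε / a * (a + t) ^ (-(1 + σ))) hGs
      (fderiv_scaledDeviation ha0.ne' hf hX hΞ) ?_ ?_ ?_ ?_ ?_ ?_ ?_ ?_ L ?_ ?_ t ht
    · intro w
      simp [hG, scaledDeviation, hX0, hΞ0]
    · simp [decayPrimitive]
    · exact fun t ht => hasDerivAt_decayPrimitive hσ ha1 ht
    · intro t ht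
      have : 0 < a + t := by linarith
      positivity
    · exact fun t ht => decayPrimitive_nonneg hε hσ ha1 ht
    · intro t ht
      refine (decayPrimitive_le hε hσ ha1 ht).trans ?_
      have h1 : a ^ (-(1 + σ)) ≤ 1 := Real.rpow_le_one_of_one_le_of_nonpos ha1 (by linarith)
      have h2 : 0 ≤ a ^ (-(1 + σ)) := Real.rpow_nonneg ha0.le _
      calc _ ≤ 1 / σ * 1 := by gcongr
        _ = _ := mul_one _
    · exact fun t => contDiff_deviationField hb ε s a t
    · intro t ht
      refine hC b hb hbA ε s a t hε hs ha1 ht _ ?_ ?_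
      · rw [hG, positionMap_scaledDeviation Xf Ξf s ha0.ne', hx]
        exact (hray t ht).1
      · rw [hG, momentumMap_scaledDeviation, hx]
        exact (hray t ht).2
    · simp [hLdef, hL]
    · intro h hh
      rw [hLdef, List.mem_append, List.mem_map, List.mem_map] at hh
      rcases hh with ⟨i, _, rfl⟩ | ⟨i, _, rfl⟩ <;> simp [Prod.norm_def]
  have hbound' : ‖dirDeriv (L.map fun h => ((0 : ℝ), h)) G (t, w₀)‖ ≤
      ε * (K / σ) * a ^ (-(1 + σ)) :=
    (hbound.trans (mul_le_mul_of_nonneg_left hr hK.le)).trans_eq (by ring)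
  have hst : ContDiff ℝ ∞ fun q : ℝ × Eu n × Eu n => (s * q.1, q.2.1, q.2.2) := by fun_prop
  have hXs : ContDiff ℝ ∞ fun q : ℝ × Eu n × Eu n => Xf (s * q.1) q.2.1 q.2.2 :=
    (contDiff_fst.comp hf).comp hst
  have hΞs : ContDiff ℝ ∞ fun q : ℝ × Eu n × Eu n => Ξf (s * q.1) q.2.1 q.2.2 :=
    (contDiff_snd.comp hf).comp hst
  have hpj : ContDiff ℝ ∞ fun v : Eu n => v j := (EuclideanSpace.proj j : Eu n →L[ℝ] ℝ).contDiff
  have hrec : ∀ g : ℝ → Eu n → Eu n → ℝ,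
      (ContDiff ℝ ∞ fun q : ℝ × Eu n × Eu n => g q.1 q.2.1 q.2.2) →
      ∀ T : Eu n × Eu n →L[ℝ] ℝ,
      (∀ q : ℝ × Eu n × Eu n, T (G q) = g q.1 (a • q.2.1) q.2.2) →
      a ^ LA.length * LA.foldr pdX (LB.foldr pdXi (g t)) x ξ =
        T (dirDeriv (L.map fun h => ((0 : ℝ), h)) G (t, w₀)) := by
    intro g hg T hT
    rw [← dirDeriv_clm_comp hGs T, funext hT, hLdef, dirDeriv_scaled hg]
    simp only [hw, smul_inv_smul₀ ha0.ne']
  have hpow : ∀ κ : ℝ, a ^ (-(LA.length + κ)) = (a ^ LA.length)⁻¹ * a ^ (-κ) := by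
    intro κ
    rw [neg_add, Real.rpow_add ha0, Real.rpow_neg ha0.le, Real.rpow_natCast]
  have hLA : 0 < a ^ LA.length := by positivity
  set D := dirDeriv (L.map fun h => ((0 : ℝ), h)) G (t, w₀) with hD
  constructor
  · have h := hrec (fun t y η => Xf (s * t) y η j - y j - 2 * (s * t) * Ξf (s * t) y η j)
      (by
        have h1 := hpj.comp hXs
        have h2 := hpj.comp hΞs
        have h3 : ContDiff ℝ ∞ fun q : ℝ × Eu n × Eu n => q.2.1 j :=
          hpj.comp (contDiff_fst.comp contDiff_snd)
        have h4 : ContDiff ℝ ∞ fun q : ℝ × Eu n × Eu n => 2 * (s * q.1) := by fun_prop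
        exact (h1.sub h3).sub (h4.mul h2))
      (a • (EuclideanSpace.proj j : Eu n →L[ℝ] ℝ).comp (ContinuousLinearMap.fst ℝ _ _))
      (fun q => by
        simp [hG, scaledDeviation, mul_inv_cancel_left₀ ha0.ne'])
    rw [hpow, ← mul_le_mul_iff_of_pos_left hLA, ← abs_of_pos hLA, ← abs_mul, h, abs_of_pos hLA]
    have h1 : |D.1 j| ≤ ‖D‖ := (PiLp.norm_apply_le D.1 j).trans (norm_fst_le D)
    have h2 : a * a ^ (-(1 + σ)) = a ^ (-σ) := by
      rw [neg_add, Real.rpow_add ha0, Real.rpow_neg_one, mul_inv_cancel_left₀ ha0.ne']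
    calc _ = a * |D.1 j| := by simp [abs_mul, abs_of_pos ha0]
      _ ≤ a * (ε * (K / σ) * a ^ (-(1 + σ))) := by gcongr; exact h1.trans hbound'
      _ = ε * (K / σ) * (a * a ^ (-(1 + σ))) := by ring
      _ = _ := by rw [h2]; field_simp
  · have h := hrec (fun t y η => Ξf (s * t) y η j - η j)
      (by
        have h2 := hpj.comp hΞs
        have h3 : ContDiff ℝ ∞ fun q : ℝ × Eu n × Eu n => q.2.2 j :=
          hpj.comp (contDiff_snd.comp contDiff_snd)
        exact h2.sub h3)
      ((EuclideanSpace.proj j : Eu n →L[ℝ] ℝ).comp (ContinuousLinearMap.snd ℝ _ _))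
      (fun q => by simp [hG, scaledDeviation])
    rw [show 1 + (LA.length : ℝ) + σ = LA.length + (1 + σ) by ring, hpow,
      ← mul_le_mul_iff_of_pos_left hLA, ← abs_of_pos hLA, ← abs_mul, h, abs_of_pos hLA]
    have h1 : |D.2 j| ≤ ‖D‖ := (PiLp.norm_apply_le D.2 j).trans (norm_snd_le D)
    calc _ = |D.2 j| := by simp
      _ ≤ ε * (K / σ) * a ^ (-(1 + σ)) := h1.trans hbound'
      _ = _ := by field_simp

theorem symbol_bounds {b : Fin n → Fin n → Eu n → ℝ} {A₀ A₁ σ : ℝ} (hσ : 0 < σ) (hA₀ : 0 < A₀)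
    (hA₁ : 0 < A₁) (h0 : ∀ j k x, |b j k x| ≤ A₀ * jb x ^ (-(1 + σ)))
    (h1 : ∀ i j k x, |pd i (b j k) x| ≤ n * (A₁ * jb x ^ (-(2 + σ)))) (x ξ : Eu n) :
    |symbolForm b x ξ| ≤ (2 * n ^ 2 * A₀ + n ^ 4 * A₁) * ‖ξ‖ ^ 2 ∧
    jb x * ‖symbolGradX b x ξ‖ ≤ (2 * n ^ 2 * A₀ + n ^ 4 * A₁) * ‖ξ‖ ^ 2 ∧
    jb x * ‖symbolGradXi b x ξ‖ ≤ (2 * n ^ 2 * A₀ + n ^ 4 * A₁) * ‖ξ‖ := by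
  have hj := one_le_jb x
  have hj0 : 0 < jb x := by linarith
  have e0 : jb x ^ (-(1 + σ)) ≤ 1 := Real.rpow_le_one_of_one_le_of_nonpos hj (by linarith)
  have e1 : jb x * jb x ^ (-(1 + σ)) ≤ 1 := by
    rw [neg_add, Real.rpow_add hj0, Real.rpow_neg_one, mul_inv_cancel_left₀ hj0.ne']
    exact Real.rpow_le_one_of_one_le_of_nonpos hj (by linarith)
  have e2 : jb x * jb x ^ (-(2 + σ)) ≤ 1 := by
    rw [show -(2 + σ) = -1 + -(1 + σ) by ring, Real.rpow_add hj0, Real.rpow_neg_one,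
      mul_inv_cancel_left₀ hj0.ne']
    exact e0
  have p0 : 0 ≤ n ^ 2 * A₀ * ‖ξ‖ ^ 2 := by positivity
  have p1 : 0 ≤ n ^ 4 * A₁ * ‖ξ‖ ^ 2 := by positivity
  have p2 : 0 ≤ 2 * n ^ 2 * A₀ * ‖ξ‖ := by positivity
  have p3 : 0 ≤ n ^ 4 * A₁ * ‖ξ‖ := by positivity
  refine ⟨?_, ?_, ?_⟩
  · refine (abs_symbolForm_le (fun j k => h0 j k x) ξ).trans ?_
    nlinarith [mul_le_of_le_one_right p0 e0]
  · refine (mul_le_mul_of_nonneg_left (norm_symbolGradX_le (fun i j k => h1 i j k x) ξ)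
      hj0.le).trans ?_
    nlinarith [mul_le_of_le_one_right p1 e2]
  · refine (mul_le_mul_of_nonneg_left (norm_symbolGradXi_le (fun j k => h0 j k x) ξ)
      hj0.le).trans ?_
    nlinarith [mul_le_of_le_one_right p2 e1]

end Deviation

theorem hasDerivAt_flow {n : ℕ} {b : Fin n → Fin n → Eu n → ℝ} (hb : ∀ j k, ContDiff ℝ ∞ (b j k))
    {ε : ℝ} {p : Eu n → Eu n → ℝ} (hp : ∀ x ξ, p x ξ = ‖ξ‖ ^ 2 + ε * ∑ j, ∑ k, b j k x * ξ j * ξ k)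
    {Xf Ξf : ℝ → Eu n → Eu n → Eu n}
    (hX : ∀ (t : ℝ) (x ξ : Eu n) (j : Fin n), HasDerivAt (fun s => Xf s x ξ j)
      (fderiv ℝ (fun η => p (Xf t x ξ) η) (Ξf t x ξ) (EuclideanSpace.single j 1)) t)
    (hΞ : ∀ (t : ℝ) (x ξ : Eu n) (j : Fin n), HasDerivAt (fun s => Ξf s x ξ j)
      (-(fderiv ℝ (fun y => p y (Ξf t x ξ)) (Xf t x ξ) (EuclideanSpace.single j 1))) t)
    (s : ℝ) (x ξ : Eu n) (t : ℝ) :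
    HasDerivAt (fun t => Xf (s * t) x ξ) (s • ((2 : ℝ) • Ξf (s * t) x ξ +
        ε • symbolGradXi b (Xf (s * t) x ξ) (Ξf (s * t) x ξ))) t ∧
      HasDerivAt (fun t => Ξf (s * t) x ξ)
        (-(s * ε) • symbolGradX b (Xf (s * t) x ξ) (Ξf (s * t) x ξ)) t := by
  have hp' : p = fun x ξ => ‖ξ‖ ^ 2 + ε * symbolForm b x ξ := funext₂ hp
  have h1 : HasDerivAt (fun t => Xf t x ξ) ((2 : ℝ) • Ξf (s * t) x ξ +
      ε • symbolGradXi b (Xf (s * t) x ξ) (Ξf (s * t) x ξ)) (s * t) :=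
    hasDerivAt_of_apply fun j => (hX (s * t) x ξ j).congr_deriv (by
      simp only [hp', fderiv_symbol_right hb]
      simp)
  have h2 : HasDerivAt (fun t => Ξf t x ξ)
      (-(ε • symbolGradX b (Xf (s * t) x ξ) (Ξf (s * t) x ξ))) (s * t) :=
    hasDerivAt_of_apply fun j => (hΞ (s * t) x ξ j).congr_deriv (by
      simp only [hp', fderiv_symbol_left hb]
      simp)
  have hs : HasDerivAt (fun t => s * t) s t := by
    simpa using (hasDerivAt_id t).const_mul s
  refine ⟨h1.scomp t hs, (h2.scomp t hs).congr_deriv ?_⟩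
  rw [smul_neg, smul_smul, neg_smul]

/-- **Proposition III.3.2.** There is `ε₀ > 0` depending only on `n, σ₀, A₀, A₁` such
that for `ε ∈ (0,ε₀)`, with `z(t,x,ξ) = x(t,x,ξ) − x − 2tξ(t,x,ξ)` and
`ζ(t,x,ξ) = ξ(t,x,ξ) − ξ`: for every `k` there is `M_k > 0`, depending only on
`k, n, σ₀` and the `A_ℓ`, such that for all multi-indices `A, B` with `|A|+|B| ≤ k`,
all `t ≥ 0` (resp. `t ≤ 0`) and `(x,ξ) ∈ 𝒮₊` (resp. `𝒮₋`) with `1/2 ≤ |ξ| ≤ 2`: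
`|∂_x^A ∂_ξ^B z| ≤ ε M_k ⟨x⟩^{−(|A|+σ₀)}` and `|∂_x^A ∂_ξ^B ζ| ≤ ε M_k ⟨x⟩^{−(1+|A|+σ₀)}`. -/
theorem statement6
    (n : ℕ) (hn : 1 ≤ n) (σ₀ : ℝ) (hσ₀ : 0 < σ₀) (hσ₀' : σ₀ < 1)
    (A₀ A₁ : ℝ) (hA₀ : 0 < A₀) (hA₁ : 0 < A₁) :
    ∃ ε₀ : ℝ, 0 < ε₀ ∧
      ∀ A : ℕ → ℝ, A 0 = A₀ → A 1 = A₁ → (∀ ℓ, 0 < A ℓ) →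
      ∀ k : ℕ, ∃ M : ℝ, 0 < M ∧
      ∀ b : Fin n → Fin n → Eu n → ℝ,
        (∀ j k', ContDiff ℝ (⊤ : ℕ∞) (b j k')) →
        (∀ (ℓ : ℕ) (x : Eu n),
          (∑ γ ∈ Finset.Nat.antidiagonalTuple n ℓ, ∑ j, ∑ k', |mderiv γ (b j k') x|) ≤
            A ℓ * jb x ^ (-(1 + (ℓ : ℝ) + σ₀))) →
      ∀ ε : ℝ, 0 < ε → ε < ε₀ → ε * A 0 ≤ 1 / 10 →
      ∀ p : Eu n → Eu n → ℝ,
        (∀ x ξ, p x ξ = ‖ξ‖ ^ 2 + ε * ∑ j, ∑ k', b j k' x * ξ j * ξ k') →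
      ∀ Xf Ξf : ℝ → Eu n → Eu n → Eu n,
        ContDiff ℝ (⊤ : ℕ∞)
          (fun q : ℝ × Eu n × Eu n => (Xf q.1 q.2.1 q.2.2, Ξf q.1 q.2.1 q.2.2)) →
        (∀ (t : ℝ) (x ξ : Eu n) (j : Fin n),
          HasDerivAt (fun s => Xf s x ξ j)
            (fderiv ℝ (fun η => p (Xf t x ξ) η) (Ξf t x ξ)
              (EuclideanSpace.single j 1)) t) →
        (∀ (t : ℝ) (x ξ : Eu n) (j : Fin n),
          HasDerivAt (fun s => Ξf s x ξ j)
            (-(fderiv ℝ (fun y => p y (Ξf t x ξ)) (Xf t x ξ)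
              (EuclideanSpace.single j 1))) t) →
        (∀ x ξ, Xf 0 x ξ = x) → (∀ x ξ, Ξf 0 x ξ = ξ) →
      ∀ Am Bm : Fin n → ℕ, mOrd Am + mOrd Bm ≤ k →
      ∀ x ξ : Eu n, 1 / 2 ≤ ‖ξ‖ → ‖ξ‖ ≤ 2 →
        (∀ t : ℝ, 0 ≤ t → -(1 / 4) * jb x * ‖ξ‖ ≤ dotp x ξ → ∀ j : Fin n,
          |mderiv2 Am Bm (fun y η => Xf t y η j - y j - 2 * t * Ξf t y η j) x ξ| ≤
              ε * M * jb x ^ (-((mOrd Am : ℝ) + σ₀)) ∧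
            |mderiv2 Am Bm (fun y η => Ξf t y η j - η j) x ξ| ≤
              ε * M * jb x ^ (-(1 + (mOrd Am : ℝ) + σ₀))) ∧
        (∀ t : ℝ, t ≤ 0 → dotp x ξ ≤ 1 / 4 * jb x * ‖ξ‖ → ∀ j : Fin n,
          |mderiv2 Am Bm (fun y η => Xf t y η j - y j - 2 * t * Ξf t y η j) x ξ| ≤
              ε * M * jb x ^ (-((mOrd Am : ℝ) + σ₀)) ∧
            |mderiv2 Am Bm (fun y η => Ξf t y η j - η j) x ξ| ≤
              ε * M * jb x ^ (-(1 + (mOrd Am : ℝ) + σ₀))) := by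
  set c : ℝ := 2 * n ^ 2 * A₀ + n ^ 4 * A₁ with hc
  have hc0 : 0 ≤ c := by positivity
  refine ⟨min 1 (1 / (20 * (c + 1))), by positivity, ?_⟩
  intro A hA0 hA1 hA k
  choose M hM hmain using exists_foldr_deviation_bound n hσ₀ A hA
  refine ⟨∑ i ∈ Finset.range (k + 1), M i, Finset.sum_pos (fun i _ => hM i) (by simp), ?_⟩
  intro b hb hbA ε hε hε0 _ p hp Xf Ξf hf hX hΞ hX0 hΞ0 Am Bm hk x ξ hξ1 hξ2
  have hε1 : ε ≤ 1 := hε0.le.trans (min_le_left _ _)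
  have hεc : ε * c ≤ 1 / 20 := by
    have h1 : ε ≤ 1 / (20 * (c + 1)) := hε0.le.trans (min_le_right _ _)
    rw [le_div_iff₀ (by positivity)] at h1
    nlinarith
  have hcoeff := norm_iteratedFDeriv_coeff_le hb hbA
  have hq := symbol_bounds hσ₀ hA₀ hA₁ (b := b)
    (fun j k x => by simpa [hA0] using hcoeff j k 0 x)
    (fun i j k x => by
      have h1 := hcoeff j k 1 x
      rw [norm_iteratedFDeriv_one] at h1
      have h2 : ‖pd i (b j k) x‖ ≤ ‖fderiv ℝ (b j k) x‖ := by
        simpa [pd] using (fderiv ℝ (b j k) x).le_opNorm (EuclideanSpace.single i 1)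
      refine (h2.trans h1).trans_eq ?_
      rw [hA1, pow_one, Nat.cast_one]
      norm_num)
  have hlen : (mIdx Am).length + (mIdx Bm).length ∈ Finset.range (k + 1) := by
    simp only [length_mIdx, Finset.mem_range]
    omega
  have hMle := Finset.single_le_sum (f := M) (fun i _ => (hM i).le) hlen
  have hkey : ∀ s : ℝ, s * s = 1 → -(1 / 4) * jb x * ‖ξ‖ ≤ s * inner ℝ x ξ → ∀ t : ℝ, 0 ≤ t →
      ∀ j : Fin n,
        |mderiv2 Am Bm (fun y η => Xf (s * t) y η j - y j - 2 * (s * t) * Ξf (s * t) y η j) x ξ| ≤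
            ε * (∑ i ∈ Finset.range (k + 1), M i) * jb x ^ (-((mOrd Am : ℝ) + σ₀)) ∧
          |mderiv2 Am Bm (fun y η => Ξf (s * t) y η j - η j) x ξ| ≤
            ε * (∑ i ∈ Finset.range (k + 1), M i) * jb x ^ (-(1 + (mOrd Am : ℝ) + σ₀)) := by
    intro s hs hout t ht j
    have h := hmain _ b hb hcoeff ε s c hε hε1 hs hεc (fun x ξ => (hq x ξ).1)
      (fun x ξ => (hq x ξ).2.1) (fun x ξ => (hq x ξ).2.2) Xf Ξf hf
      (fun x ξ t => (hasDerivAt_flow hb hp hX hΞ s x ξ t).1)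
      (fun x ξ t => (hasDerivAt_flow hb hp hX hΞ s x ξ t).2) hX0 hΞ0 (mIdx Am) (mIdx Bm) rfl
      x ξ hξ1 hξ2 hout t ht j
    have hj : ∀ κ : ℝ, 0 ≤ jb x ^ κ := fun κ =>
      Real.rpow_nonneg (zero_le_one.trans (one_le_jb x)) κ
    rw [← length_mIdx Am]
    exact ⟨h.1.trans (mul_le_mul_of_nonneg_right (mul_le_mul_of_nonneg_left hMle hε.le) (hj _)),
      h.2.trans (mul_le_mul_of_nonneg_right (mul_le_mul_of_nonneg_left hMle hε.le) (hj _))⟩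
  refine ⟨fun t ht hout => ?_, fun t ht hout => ?_⟩
  · rw [dotp_eq_inner] at hout
    simpa only [one_mul] using hkey 1 (one_mul 1) (by linarith) t ht
  · rw [dotp_eq_inner] at hout
    simpa only [neg_mul_neg, one_mul] using hkey (-1) (by norm_num) (by linarith) (-t) (by linarith)

end Paper
end
end

section
/- Let n ≥ 1. There exist maps q_j : ℝⁿ × ℂⁿ × 𝒮(ℝⁿ) → ℂ (j = 1,…,n) and r : ℂⁿ × 𝒮(ℝⁿ) → ℂ, linear in the argument g ∈ 𝒮(ℝⁿ) and C^∞ in (ξ,z), such that for every g ∈ 𝒮(ℝⁿ), every ξ ∈ ℝⁿ and every z ∈ ℂⁿ: g(ξ) = Σ_{j=1}^n q_j(ξ,z,g)(ξ_j + z_j) + r(z,g), and for all multi-indices α (in ξ) and β (in the 2n real coordinates of z) there are constants C_{αβ} and C_β, depending only on n, α, β, with |∂_ξ^α ∂_z^β q_j(ξ,z,g)| ≤ C_{αβ} Σ_{|γ| ≤ |α|+|β|+4n} ∫_{ℝⁿ} |∂_η^γ g(η)| dη for j = 1,…,n, and |∂_z^β r(z,g)| ≤ C_β Σ_{|γ|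 ≤ |β|+3n} ∫_{ℝⁿ} |∂_η^γ g(η)| dη. -/
open MeasureTheory
open scoped BigOperators

noncomputable section

namespace Paper

/-- `ℂⁿ`. -/
abbrev Cz (n : ℕ) := EuclideanSpace ℂ (Fin n)

/-- The space `ℝⁿ_ξ × ℂⁿ_z`. -/
abbrev W (n : ℕ) := Eu n × Cz n

/-- Real directional derivative on `W n`. -/
def wd {n : ℕ} (v : W n) (f : W n → ℂ) : W n → ℂ := fun w => fderiv ℝ f w v

/-- Iterated real directional derivatives along a list of directions. -/
def wdList {n : ℕ} (l : List (W n)) (f : W n → ℂ) : W n → ℂ := l.foldr wd f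

/-- Real directional derivative on `ℂⁿ`. -/
def cd {n : ℕ} (v : Cz n) (f : Cz n → ℂ) : Cz n → ℂ := fun z => fderiv ℝ f z v

/-- Iterated derivatives on `ℂⁿ`. -/
def cdList {n : ℕ} (l : List (Cz n)) (f : Cz n → ℂ) : Cz n → ℂ := l.foldr cd f

/-- A coordinate direction in the `ξ`-variables. -/
def dirXi {n : ℕ} (i : Fin n) : W n := (EuclideanSpace.single i 1, 0)

/-- A real coordinate direction in the `z`-variables. -/
def dirRe {n : ℕ} (i : Fin n) : W n := (0, EuclideanSpace.single i 1)

/-- An imaginary coordinate direction in the `z`-variables. -/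
def dirIm {n : ℕ} (i : Fin n) : W n := (0, EuclideanSpace.single i Complex.I)

/-- First-order partial derivative `∂/∂ξᵢ` on `ℝⁿ`. -/
def pdE {n : ℕ} (i : Fin n) (f : Eu n → ℂ) : Eu n → ℂ :=
  fun x => fderiv ℝ f x (EuclideanSpace.single i 1)

/-- The multi-index partial derivative `∂^γ`. -/
def mderivE {n : ℕ} (γ : Fin n → ℕ) (f : Eu n → ℂ) : Eu n → ℂ :=
  (mIdx γ).foldr pdE f

section BoundedDerivatives

open Set

variable {E F G : Type*} [NormedAddCommGroup E] [NormedSpace ℝ E] [NormedAddCommGroup F]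
  [NormedSpace ℝ F] [NormedAddCommGroup G] [NormedSpace ℝ G]

/-- `f` is `C^N` on `s`, with derivatives up to order `N` bounded on `s`. -/
def BddDerivOn (N : ℕ) (f : E → F) (s : Set E) : Prop :=
  ContDiffOn ℝ N f s ∧ ∀ k ≤ N, ∃ C, ∀ x ∈ s, ‖iteratedFDerivWithin ℝ k f s x‖ ≤ C

theorem BddDerivOn.congr {N : ℕ} {f g : E → F} {s : Set E} (hf : BddDerivOn N f s)
    (h : EqOn g f s) : BddDerivOn N g s := by
  refine ⟨hf.1.congr h, fun k hk => ?_⟩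
  obtain ⟨C, hC⟩ := hf.2 k hk
  refine ⟨C, fun x hx => ?_⟩
  rw [iteratedFDerivWithin_congr h hx]
  exact hC x hx

theorem BddDerivOn.mono {N : ℕ} {f : E → F} {s t : Set E} (hf : BddDerivOn N f s)
    (hs : IsOpen s) (ht : IsOpen t) (hts : t ⊆ s) : BddDerivOn N f t := by
  refine ⟨hf.1.mono hts, fun k hk => ?_⟩
  obtain ⟨C, hC⟩ := hf.2 k hk
  refine ⟨C, fun x hx => ?_⟩
  rw [iteratedFDerivWithin_of_isOpen k ht hx, ← iteratedFDerivWithin_of_isOpen k hs (hts hx)]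
  exact hC x (hts hx)

theorem BddDerivOn.const (N : ℕ) (c : F) {s : Set E} (hs : IsOpen s) :
    BddDerivOn N (fun _ => c) s := by
  refine ⟨contDiffOn_const, fun k _ => ?_⟩
  rcases Nat.eq_zero_or_pos k with rfl | hk
  · exact ⟨‖c‖, fun x _ => by simp⟩
  · refine ⟨0, fun x hx => ?_⟩
    rw [iteratedFDerivWithin_of_isOpen k hs hx, iteratedFDeriv_const_of_ne hk.ne']
    simp

theorem BddDerivOn.add {N : ℕ} {f g : E → F} {s : Set E} (hf : BddDerivOn N f s)
    (hg : BddDerivOn N g s) (hs : IsOpen s) : BddDerivOn N (fun x => f x + g x) s := by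
  refine ⟨hf.1.add hg.1, fun k hk => ?_⟩
  obtain ⟨C, hC⟩ := hf.2 k hk
  obtain ⟨D, hD⟩ := hg.2 k hk
  refine ⟨C + D, fun x hx => ?_⟩
  have hk' : (k : WithTop ℕ∞) ≤ N := by exact_mod_cast hk
  rw [fun_iteratedFDerivWithin_add_apply ((hf.1 x hx).of_le hk') ((hg.1 x hx).of_le hk')
    hs.uniqueDiffOn hx]
  exact (norm_add_le _ _).trans (add_le_add (hC x hx) (hD x hx))

theorem BddDerivOn.mul {N : ℕ} {f g : E → ℂ} {s : Set E} (hf : BddDerivOn N f s)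
    (hg : BddDerivOn N g s) (hs : IsOpen s) : BddDerivOn N (fun x => f x * g x) s := by
  refine ⟨hf.1.mul hg.1, fun k hk => ?_⟩
  have hb : ∀ {h : E → ℂ}, BddDerivOn N h s → ∀ i, ∃ C, i ≤ k → ∀ x ∈ s,
      ‖iteratedFDerivWithin ℝ i h s x‖ ≤ C := fun hh i => by
    by_cases hi : i ≤ k
    · obtain ⟨C, hC⟩ := hh.2 i (hi.trans hk)
      exact ⟨C, fun _ => hC⟩
    · exact ⟨0, fun h => absurd h hi⟩
  choose C hC using hb hf
  choose D hD using hb hg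
  refine ⟨∑ i ∈ Finset.range (k + 1), (k.choose i : ℝ) * C i * D (k - i), fun x hx => ?_⟩
  refine (norm_iteratedFDerivWithin_mul_le hf.1 hg.1 hs.uniqueDiffOn hx
    (by exact_mod_cast hk)).trans (Finset.sum_le_sum fun i hi => ?_)
  have hi' : i ≤ k := Nat.lt_succ_iff.1 (Finset.mem_range.1 hi)
  have h1 := hC i hi' x hx
  have h2 := hD (k - i) (Nat.sub_le _ _) x hx
  gcongr
  exact mul_nonneg (by positivity) ((norm_nonneg _).trans h1)

theorem BddDerivOn.clm_comp {N : ℕ} {f : E → F} {s : Set E} (hf : BddDerivOn N f s)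
    (hs : IsOpen s) (L : F →L[ℝ] G) : BddDerivOn N (fun x => L (f x)) s := by
  refine ⟨L.contDiff.comp_contDiffOn hf.1, fun k hk => ?_⟩
  obtain ⟨C, hC⟩ := hf.2 k hk
  refine ⟨‖L‖ * C, fun x hx => ?_⟩
  refine (L.norm_iteratedFDerivWithin_comp_left (hf.1 x hx) hs.uniqueDiffOn hx
    (by exact_mod_cast hk)).trans ?_
  gcongr
  exact hC x hx

theorem BddDerivOn.comp_clm {N : ℕ} {f : F → G} (hf : BddDerivOn N f univ) (L : E →L[ℝ] F) :
    BddDerivOn N (fun x => f (L x)) univ := by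
  have hf1 : ContDiff ℝ N f := contDiffOn_univ.1 hf.1
  refine ⟨(hf1.comp L.contDiff).contDiffOn, fun k hk => ?_⟩
  obtain ⟨C, hC⟩ := hf.2 k hk
  refine ⟨C * ‖L‖ ^ k, fun x _ => ?_⟩
  have h1 := L.iteratedFDeriv_comp_right hf1 x (i := k) (by exact_mod_cast hk)
  rw [iteratedFDerivWithin_univ]
  change ‖iteratedFDeriv ℝ k (f ∘ L) x‖ ≤ _
  rw [h1]
  refine (ContinuousMultilinearMap.norm_compContinuousLinearMap_le _ _).trans ?_
  have := hC (L x) (mem_univ _)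
  rw [iteratedFDerivWithin_univ] at this
  simp only [Finset.prod_const, Finset.card_univ, Fintype.card_fin]
  gcongr

theorem BddDerivOn.of_fderivWithin {N : ℕ} {f : E → F} {s : Set E} (hs : IsOpen s)
    (hd : DifferentiableOn ℝ f s) (hb : ∃ C, ∀ x ∈ s, ‖f x‖ ≤ C)
    (h : BddDerivOn N (fderivWithin ℝ f s) s) : BddDerivOn (N + 1) f s := by
  refine ⟨?_, fun k hk => ?_⟩
  · push_cast
    exact (contDiffOn_succ_iff_fderivWithin hs.uniqueDiffOn).2 ⟨hd, by simp, h.1⟩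
  · rcases k with _ | k
    · simpa using hb
    · obtain ⟨C, hC⟩ := h.2 k (by omega)
      refine ⟨C, fun x hx => ?_⟩
      rw [← norm_iteratedFDerivWithin_fderivWithin hs.uniqueDiffOn hx]
      exact hC x hx

/-- A bounded solution of `Df = f (a + b f) • c` has bounded derivatives of all orders. -/
theorem BddDerivOn.of_ode {f : E → ℂ} {s : Set E} (hs : IsOpen s)
    (hb : ∃ C, ∀ x ∈ s, ‖f x‖ ≤ C) (a b : ℂ) (c : E →L[ℝ] ℂ)
    (h : ∀ x ∈ s, HasFDerivAt f ((f x * (a + b * f x)) • c) x) (N : ℕ) : BddDerivOn N f s := by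
  have hd : DifferentiableOn ℝ f s := fun x hx => (h x hx).differentiableAt.differentiableWithinAt
  induction N with
  | zero =>
    refine ⟨by simpa using hd.continuousOn, fun k hk => ?_⟩
    obtain rfl : k = 0 := by omega
    simpa using hb
  | succ N ih =>
    refine of_fderivWithin hs hd hb ?_
    have h1 : BddDerivOn N (fun x => f x * (a + b * f x)) s :=
      ih.mul ((const N a hs).add ((const N b hs).mul ih hs) hs) hs
    refine (h1.clm_comp hs
      ((ContinuousLinearMap.toSpanSingleton ℂ c).restrictScalars ℝ)).congr fun x hx => ?_
    rw [fderivWithin_of_isOpen hs hx, (h x hx).fderiv]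
    simp

theorem BddDerivOn.of_compact {N : ℕ} {f : E → F} {s K : Set E} (hs : IsOpen s)
    (hK : IsCompact K) (hsK : K ∪ s = univ) (hf : ContDiff ℝ N f) (h : BddDerivOn N f s) :
    BddDerivOn N f univ := by
  refine ⟨hf.contDiffOn, fun k hk => ?_⟩
  obtain ⟨C, hC⟩ := h.2 k hk
  obtain ⟨D, hD⟩ := hK.exists_bound_of_continuousOn
    (hf.continuous_iteratedFDeriv (m := k) (by exact_mod_cast hk)).continuousOn
  refine ⟨max C D, fun x _ => ?_⟩
  rw [iteratedFDerivWithin_univ]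
  rcases (hsK ▸ mem_univ x : x ∈ K ∪ s) with hx | hx
  · exact (hD x hx).trans (le_max_right _ _)
  · rw [← iteratedFDerivWithin_of_isOpen k hs hx]
    exact (hC x hx).trans (le_max_left _ _)

end BoundedDerivatives

section Kernel

open Set Filter Topology

/-- A smooth compactly supported function on `ℝ` which equals `exp` near `0`. -/
theorem exists_cutoff_exp : ∃ ψ : ℝ → ℂ, (∀ N, BddDerivOn N ψ univ) ∧
    ContDiff ℝ (⊤ : ℕ∞) ψ ∧ ∀ y, |y| ≤ 1 → ψ y = Complex.exp y := by
  let χ : ContDiffBump (0 : ℝ) := ⟨1, 2, one_pos, one_lt_two⟩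
  have hs : ContDiff ℝ (⊤ : ℕ∞) (fun y : ℝ => (χ y : ℂ) * Complex.exp y) :=
    (Complex.ofRealCLM.contDiff.comp χ.contDiff).mul
      (Complex.contDiff_exp.comp Complex.ofRealCLM.contDiff)
  have hc : HasCompactSupport (fun y : ℝ => (χ y : ℂ) * Complex.exp y) :=
    (χ.hasCompactSupport.comp_left (g := fun x : ℝ => (x : ℂ)) (by simp)).mul_right
  refine ⟨_, fun N => ⟨(hs.of_le (by exact_mod_cast le_top)).contDiffOn, fun k _ => ?_⟩, hs,
    fun y hy => ?_⟩
  · have h1 : Continuous (iteratedFDeriv ℝ k (fun y : ℝ => (χ y : ℂ) * Complex.exp y)) :=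
      hs.continuous_iteratedFDeriv (by exact_mod_cast le_top)
    obtain ⟨C, hC⟩ := h1.bounded_above_of_compact_support (hc.iteratedFDeriv k)
    exact ⟨C, fun x _ => by rw [iteratedFDerivWithin_univ]; exact hC x⟩
  · have : χ y = 1 := χ.one_of_mem_closedBall (by simpa using hy)
    simp [this]

theorem contDiff_cexp_mul_I : ContDiff ℝ (⊤ : ℕ∞) (fun s : ℝ => Complex.exp (s * Complex.I)) :=
  Complex.contDiff_exp.comp (Complex.ofRealCLM.contDiff.mul contDiff_const)

theorem bddDerivOn_cexp_mul_I (N : ℕ) :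
    BddDerivOn N (fun s : ℝ => Complex.exp (s * Complex.I)) univ := by
  refine BddDerivOn.of_ode isOpen_univ ⟨1, fun s _ => ?_⟩ 1 0
    (Complex.ofRealCLM.smulRight Complex.I) (fun s _ => ?_) N
  · rw [Complex.norm_exp_ofReal_mul_I]
  · have h1 : HasFDerivAt (fun s : ℝ => (s : ℂ) * Complex.I)
        (Complex.ofRealCLM.smulRight Complex.I) s :=
      (Complex.ofRealCLM.smulRight Complex.I).hasFDerivAt
    convert h1.cexp using 2
    simp

theorem bddDerivOn_inv (N : ℕ) :
    BddDerivOn N (fun ζ : ℂ => ζ⁻¹) (Metric.closedBall (0 : ℂ) 2⁻¹)ᶜ := by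
  have hlt : ∀ ζ ∈ (Metric.closedBall (0 : ℂ) 2⁻¹)ᶜ, 2⁻¹ < ‖ζ‖ := fun ζ h => by simpa using h
  refine BddDerivOn.of_ode Metric.isClosed_closedBall.isOpen_compl ⟨2, fun ζ h => ?_⟩ 0 (-1)
    (ContinuousLinearMap.id ℝ ℂ) (fun ζ h => ?_) N
  · rw [norm_inv]
    exact inv_le_of_inv_le₀ (by norm_num) (hlt ζ h).le
  · have h0 : ζ ≠ 0 := norm_pos_iff.1 (lt_trans (by norm_num) (hlt ζ h))
    refine ((hasDerivAt_inv h0).hasFDerivAt.restrictScalars ℝ).congr_fderiv ?_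
    refine ContinuousLinearMap.ext fun v => ?_
    simp
    field_simp

/-- An extension `R` of `x ↦ exp (-ix)` to `ℂ`, holomorphic near the real axis, for which `R` and
the difference quotient `(1 - R ζ) / ζ` are smooth with bounded derivatives. -/
theorem exists_division_kernel : ∃ R H : ℂ → ℂ,
    ContDiff ℝ (⊤ : ℕ∞) R ∧ ContDiff ℝ (⊤ : ℕ∞) H ∧
    (∀ N, BddDerivOn N R univ) ∧ (∀ N, BddDerivOn N H univ) ∧
    (∀ ζ, ζ * H ζ = 1 - R ζ) ∧
    ∀ (s : ℝ) (ω : ℂ), Complex.exp (s * Complex.I) * R (s + ω) = R ω := by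
  obtain ⟨ψ, hψb, hψs, hψ⟩ := exists_cutoff_exp
  let R : ℂ → ℂ := fun ζ => Complex.exp (((-Complex.reCLM) ζ : ℝ) * Complex.I) * ψ (Complex.imCLM ζ)
  have hRs : ContDiff ℝ (⊤ : ℕ∞) R :=
    (contDiff_cexp_mul_I.comp (-Complex.reCLM).contDiff).mul (hψs.comp Complex.imCLM.contDiff)
  have hRb : ∀ N, BddDerivOn N R univ := fun N =>
    ((bddDerivOn_cexp_mul_I N).comp_clm (-Complex.reCLM)).mul ((hψb N).comp_clm Complex.imCLM)
      isOpen_univ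
  have hR0 : ∀ ζ : ℂ, |ζ.im| ≤ 1 → R ζ = Complex.exp (-(Complex.I * ζ)) := fun ζ h => by
    simp only [R, Complex.imCLM_apply]
    rw [hψ _ h, ← Complex.exp_add]
    congr 1
    apply Complex.ext <;> simp
  let e : ℂ → ℂ := fun ζ => Complex.exp (-(Complex.I * ζ))
  have he : Differentiable ℂ e := by fun_prop
  have hev : ∀ᶠ ζ in 𝓝 (0 : ℂ), R ζ = e ζ := by
    filter_upwards [Metric.closedBall_mem_nhds (0 : ℂ) one_pos] with ζ h
    exact hR0 ζ ((Complex.abs_im_le_norm ζ).trans (by simpa using h))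
  have hR1 : R 0 = 1 := by rw [hR0 0 (by simp)]; simp
  let H : ℂ → ℂ := fun ζ => -dslope R 0 ζ
  have hH : ∀ ζ, ζ * H ζ = 1 - R ζ := fun ζ => by
    have := sub_smul_dslope R 0 ζ
    simp only [sub_zero, smul_eq_mul, hR1] at this
    simp only [H]
    rw [mul_neg, this]; ring
  have hH' : ∀ ζ ≠ 0, H ζ = (1 + (-1) * R ζ) * ζ⁻¹ := fun ζ h => by
    rw [eq_mul_inv_iff_mul_eq₀ h, mul_comm, hH]; ring
  have hHev : ∀ᶠ ζ in 𝓝 (0 : ℂ), H ζ = -dslope e 0 ζ := by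
    filter_upwards [hev] with ζ h
    rcases eq_or_ne ζ 0 with rfl | h0
    · simp only [H, dslope_same]
      rw [EventuallyEq.deriv_eq hev]
    · simp only [H, dslope_of_ne _ h0, slope_def_field, h, hev.self_of_nhds]
  have hHs : ContDiff ℝ (⊤ : ℕ∞) H := by
    rw [contDiff_iff_contDiffAt]
    intro ζ
    rcases eq_or_ne ζ 0 with rfl | h0
    · have hd : Differentiable ℂ (dslope e 0) := by
        rw [← differentiableOn_univ, Complex.differentiableOn_dslope univ_mem]
        exact he.differentiableOn
      have : ContDiff ℝ (⊤ : ℕ∞) (dslope e 0) := hd.contDiff.restrict_scalars ℝ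
      exact this.neg.contDiffAt.congr_of_eventuallyEq hHev
    · have h1 : ContDiffAt ℝ (⊤ : ℕ∞) (fun ζ => (1 + (-1) * R ζ) * ζ⁻¹) ζ :=
        (contDiff_const.add (contDiff_const.mul hRs)).contDiffAt.mul (contDiffAt_inv ℝ h0)
      refine h1.congr_of_eventuallyEq ?_
      filter_upwards [isOpen_ne.mem_nhds h0] with ζ' h'
      exact hH' ζ' h'
  refine ⟨R, H, hRs, hHs, hRb, fun N => ?_, hH, fun s ω => ?_⟩
  · have ho : IsOpen (Metric.closedBall (0 : ℂ) 2⁻¹)ᶜ := Metric.isClosed_closedBall.isOpen_compl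
    refine BddDerivOn.of_compact ho (isCompact_closedBall 0 2⁻¹) (union_compl_self _)
      (hHs.of_le (by exact_mod_cast le_top)) ?_
    refine ((((BddDerivOn.const N 1 ho).add ((BddDerivOn.const N (-1) ho).mul
      ((hRb N).mono isOpen_univ ho (subset_univ _)) ho) ho)).mul (bddDerivOn_inv N) ho).congr ?_
    intro ζ h
    refine hH' ζ ?_
    rintro rfl
    exact h (by simp)
  · simp only [R]
    rw [← mul_assoc, ← Complex.exp_add]
    simp
    ring_nf
    simp

end Kernel

section Superposition

open Filter Topology

variable {E V : Type*} [NormedAddCommGroup E] [NormedSpace ℝ E] [NormedAddCommGroup V]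
  [NormedSpace ℝ V]

set_option maxSynthPendingDepth 5 in
theorem hasFTaylorSeriesUpTo_integral {α F : Type*} [MeasurableSpace α] {μ : Measure α}
    [NormedAddCommGroup F] [NormedSpace ℝ F] [CompleteSpace F] {f : E → α → F}
    {p : E → α → FormalMultilinearSeries ℝ E F}
    (hp : ∀ t, HasFTaylorSeriesUpTo (⊤ : ℕ∞) (fun w => f w t) fun w => p w t)
    (hI : ∀ w k, Integrable (fun t => p w t k) μ)
    (hbd : ∀ k, ∃ b : α → ℝ, Integrable b μ ∧ ∀ t w, ‖p w t k‖ ≤ b t) :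
    HasFTaylorSeriesUpTo (⊤ : ℕ∞) (fun w => ∫ t, f w t ∂μ) fun w k => ∫ t, p w t k ∂μ := by
  have hd : ∀ (k : ℕ) (w : E), HasFDerivAt (fun w => ∫ t, p w t k ∂μ)
      (∫ t, p w t (k + 1) ∂μ).curryLeft w := by
    intro k w
    obtain ⟨b, hbI, hb⟩ := hbd (k + 1)
    let D : E → α → E →L[ℝ] ContinuousMultilinearMap ℝ (fun _ : Fin k => E) F :=
      fun w t => (p w t (k + 1)).curryLeft
    have hDn : ∀ w t, ‖D w t‖ = ‖p w t (k + 1)‖ := fun w t =>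
      ContinuousMultilinearMap.curryLeft_norm _
    have hcm : AEStronglyMeasurable (D w) μ :=
      (continuousMultilinearCurryLeftEquiv ℝ (fun _ : Fin (k + 1) => E)
        F).continuous.comp_aestronglyMeasurable
        (hI w (k + 1)).aestronglyMeasurable
    have hcI : Integrable (D w) μ :=
      (hI w (k + 1)).mono hcm (Eventually.of_forall fun t => (hDn w t).le)
    have hcl : (∫ t, p w t (k + 1) ∂μ).curryLeft = ∫ t, D w t ∂μ := by
      ext v m
      rw [ContinuousLinearMap.integral_apply hcI, ContinuousMultilinearMap.curryLeft_apply,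
        ContinuousMultilinearMap.integral_apply (hI w (k + 1)),
        ContinuousMultilinearMap.integral_apply (hcI.apply_continuousLinearMap v)]
      rfl
    rw [hcl]
    refine hasFDerivAt_integral_of_dominated_of_fderiv_le (s := Set.univ) (F' := D) (bound := b)
      univ_mem (Eventually.of_forall fun w => (hI w k).aestronglyMeasurable) (hI w k) hcm
      (Eventually.of_forall fun t w _ => ?_) hbI (Eventually.of_forall fun t w _ => ?_)
    · rw [hDn]
      exact hb t w
    · exact (hp t).fderiv k (by exact_mod_cast WithTop.coe_lt_top k) w
  refine ⟨fun w => ?_, fun k _ w => hd k w, fun k _ => ?_⟩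
  · rw [ContinuousMultilinearMap.curry0_apply, ContinuousMultilinearMap.integral_apply (hI w 0)]
    exact integral_congr_ae (Eventually.of_forall fun t => (hp t).zero_eq w)
  · exact continuous_iff_continuousAt.2 fun w => (hd k w).continuousAt

/-- The `k`-th derivative in `w` of `a t * Φ (Λ t w)`. -/
def superposedDeriv {n : ℕ} (Φ : V → ℂ) (a : Eu n → ℂ) (Λ : Eu n →L[ℝ] E →L[ℝ] V) (w : E) (k : ℕ)
    (t : Eu n) : ContinuousMultilinearMap ℝ (fun _ : Fin k => E) ℂ :=
  a t • (iteratedFDeriv ℝ k Φ (Λ t w)).compContinuousLinearMap fun _ => Λ t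

variable {n : ℕ} {Φ : V → ℂ} {a : Eu n → ℂ} {Λ : Eu n →L[ℝ] E →L[ℝ] V}

theorem iteratedFDeriv_superposed (hΦ : ContDiff ℝ (⊤ : ℕ∞) Φ) (t : Eu n) (w : E) (k : ℕ) :
    iteratedFDeriv ℝ k (fun w => a t * Φ (Λ t w)) w = superposedDeriv Φ a Λ w k t := by
  have h1 : ContDiff ℝ (⊤ : ℕ∞) (Φ ∘ Λ t) := hΦ.comp (Λ t).contDiff
  change iteratedFDeriv ℝ k (a t • (Φ ∘ Λ t)) w = _
  rw [iteratedFDeriv_const_smul_apply (h1.contDiffAt.of_le (by exact_mod_cast le_top)),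
    (Λ t).iteratedFDeriv_comp_right hΦ w (by exact_mod_cast le_top)]
  rfl

theorem norm_superposedDeriv_le {k : ℕ} {C : ℝ}
    (hC : ∀ v, ‖iteratedFDeriv ℝ k Φ v‖ ≤ C) (w : E) (t : Eu n) :
    ‖superposedDeriv Φ a Λ w k t‖ ≤ C * ‖Λ‖ ^ k * (‖t‖ ^ k * ‖a t‖) := by
  have hC0 : 0 ≤ C := (norm_nonneg _).trans (hC 0)
  have h1 := ContinuousMultilinearMap.norm_compContinuousLinearMap_le
    (iteratedFDeriv ℝ k Φ (Λ t w)) fun _ => Λ t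
  simp only [Finset.prod_const, Finset.card_univ, Fintype.card_fin] at h1
  rw [superposedDeriv, norm_smul]
  calc ‖a t‖ * ‖(iteratedFDeriv ℝ k Φ (Λ t w)).compContinuousLinearMap fun _ => Λ t‖
      ≤ ‖a t‖ * (C * (‖Λ‖ * ‖t‖) ^ k) := by
        gcongr
        refine h1.trans ?_
        gcongr
        · exact hC _
        · exact Λ.le_opNorm t
    _ = _ := by rw [mul_pow]; ring

theorem continuous_superposedDeriv (hΦ : ContDiff ℝ (⊤ : ℕ∞) Φ) (ha : Continuous a) (w : E)
    (k : ℕ) : Continuous (superposedDeriv Φ a Λ w k) := by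
  have h1 : Continuous fun t => iteratedFDeriv ℝ k Φ (Λ t w) :=
    (hΦ.continuous_iteratedFDeriv (by exact_mod_cast le_top)).comp (by fun_prop)
  have h2 : Continuous fun t =>
      ContinuousMultilinearMap.compContinuousLinearMapContinuousMultilinear ℝ
        (fun _ : Fin k => E) (fun _ => V) ℂ (fun _ => Λ t) :=
    (ContinuousMultilinearMap.cont _).comp (continuous_pi fun _ => Λ.continuous)
  exact ha.smul (h2.clm_apply h1)

theorem integrable_superposedDeriv (hΦ : ContDiff ℝ (⊤ : ℕ∞) Φ)
    (hb : ∀ N, BddDerivOn N Φ Set.univ) (ha : Continuous a)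
    (hi : ∀ k : ℕ, Integrable fun t => ‖t‖ ^ k * ‖a t‖) (w : E) (k : ℕ) :
    Integrable (superposedDeriv Φ a Λ w k) := by
  obtain ⟨C, hC⟩ := (hb k).2 k le_rfl
  simp only [iteratedFDerivWithin_univ, Set.mem_univ, forall_const] at hC
  exact ((hi k).const_mul (C * ‖Λ‖ ^ k)).mono'
    (continuous_superposedDeriv hΦ ha w k).aestronglyMeasurable
    (Eventually.of_forall fun t => norm_superposedDeriv_le hC w t)

theorem hasFTaylorSeriesUpTo_superposition (hΦ : ContDiff ℝ (⊤ : ℕ∞) Φ)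
    (hb : ∀ N, BddDerivOn N Φ Set.univ) (ha : Continuous a)
    (hi : ∀ k : ℕ, Integrable fun t => ‖t‖ ^ k * ‖a t‖) :
    HasFTaylorSeriesUpTo (⊤ : ℕ∞) (fun w => ∫ t, a t * Φ (Λ t w))
      fun w k => ∫ t, superposedDeriv Φ a Λ w k t := by
  have hs : ∀ t, ContDiff ℝ (⊤ : ℕ∞) fun w => a t * Φ (Λ t w) := fun t =>
    contDiff_const.mul (hΦ.comp (Λ t).contDiff)
  have hp : ∀ t, HasFTaylorSeriesUpTo (⊤ : ℕ∞) (fun w => a t * Φ (Λ t w))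
      fun w k => superposedDeriv Φ a Λ w k t := fun t => by
    have h := (hs t).ftaylorSeries
    unfold ftaylorSeries at h
    simpa only [iteratedFDeriv_superposed hΦ] using h
  refine hasFTaylorSeriesUpTo_integral hp (fun w k => integrable_superposedDeriv hΦ hb ha hi w k)
    fun k => ?_
  obtain ⟨C, hC⟩ := (hb k).2 k le_rfl
  simp only [iteratedFDerivWithin_univ, Set.mem_univ, forall_const] at hC
  exact ⟨_, (hi k).const_mul (C * ‖Λ‖ ^ k), fun t w => norm_superposedDeriv_le hC w t⟩

theorem contDiff_superposition (hΦ : ContDiff ℝ (⊤ : ℕ∞) Φ)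
    (hb : ∀ N, BddDerivOn N Φ Set.univ) (ha : Continuous a)
    (hi : ∀ k : ℕ, Integrable fun t => ‖t‖ ^ k * ‖a t‖) :
    ContDiff ℝ (⊤ : ℕ∞) (fun w => ∫ t, a t * Φ (Λ t w)) :=
  (hasFTaylorSeriesUpTo_superposition hΦ hb ha hi).contDiff

theorem exists_norm_iteratedFDeriv_superposition_le (hΦ : ContDiff ℝ (⊤ : ℕ∞) Φ)
    (hb : ∀ N, BddDerivOn N Φ Set.univ) (Λ : Eu n →L[ℝ] E →L[ℝ] V) (k : ℕ) :
    ∃ C, 0 ≤ C ∧ ∀ a : Eu n → ℂ, Continuous a →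
      (∀ k : ℕ, Integrable fun t => ‖t‖ ^ k * ‖a t‖) → ∀ w : E,
        ‖iteratedFDeriv ℝ k (fun w => ∫ t, a t * Φ (Λ t w)) w‖ ≤ C * ∫ t, ‖t‖ ^ k * ‖a t‖ := by
  obtain ⟨C, hC⟩ := (hb k).2 k le_rfl
  simp only [iteratedFDerivWithin_univ, Set.mem_univ, forall_const] at hC
  have hC0 : 0 ≤ C := (norm_nonneg _).trans (hC 0)
  refine ⟨C * ‖Λ‖ ^ k, by positivity, fun a ha hi w => ?_⟩
  rw [← (hasFTaylorSeriesUpTo_superposition hΦ hb ha hi).eq_iteratedFDeriv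
    (by exact_mod_cast le_top), ← integral_const_mul]
  exact norm_integral_le_of_norm_le ((hi k).const_mul _)
    (Eventually.of_forall fun t => norm_superposedDeriv_le hC w t)

theorem foldr_fderiv_eq_iteratedFDeriv {f : E → ℂ} (hf : ContDiff ℝ (⊤ : ℕ∞) f) (l : List E) :
    l.foldr (fun v g w => fderiv ℝ g w v) f =
      fun w => iteratedFDeriv ℝ l.length f w fun i => l.get i := by
  induction l with
  | nil => ext w; simp
  | cons v l ih =>
    ext w
    have hd : DifferentiableAt ℝ (iteratedFDeriv ℝ l.length f) w :=
      (hf.differentiable_iteratedFDeriv (by exact_mod_cast WithTop.coe_lt_top _)) w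
    rw [List.foldr_cons, ih]
    simp only [List.length_cons, iteratedFDeriv_succ_apply_left]
    rw [fderiv_continuousMultilinear_apply_const_apply hd]
    rfl

theorem norm_foldr_fderiv_le {f : E → ℂ} (hf : ContDiff ℝ (⊤ : ℕ∞) f) (l : List E)
    (hl : ∀ v ∈ l, ‖v‖ ≤ 1) (w : E) :
    ‖l.foldr (fun v g w => fderiv ℝ g w v) f w‖ ≤ ‖iteratedFDeriv ℝ l.length f w‖ := by
  rw [foldr_fderiv_eq_iteratedFDeriv hf]
  refine (ContinuousMultilinearMap.le_opNorm _ _).trans ?_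
  exact mul_le_of_le_one_right (norm_nonneg _)
    (Finset.prod_le_one (fun _ _ => norm_nonneg _) fun i _ => hl _ (l.get_mem i))

end Superposition

section FourierDecay

open Filter FourierTransform SchwartzMap
open scoped LineDeriv

variable {n : ℕ}

theorem mIdx_single (i : Fin n) (N : ℕ) : mIdx (Pi.single i N) = List.replicate N i := by
  have h : ∀ l : List (Fin n), l.foldr
      (fun j acc => List.replicate ((Pi.single i N : Fin n → ℕ) j) j ++ acc) [] =
        List.replicate (l.count i * N) i := by
    intro l
    induction l with
    | nil => simp
    | cons j l ih =>
      rw [List.foldr_cons, ih]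
      rcases eq_or_ne j i with rfl | hj
      · simp [add_mul, add_comm]
      · simp [hj]
  rw [mIdx, h, List.count_eq_one_of_mem (List.nodup_finRange n) (List.mem_finRange i), one_mul]

theorem foldr_pdE_replicate (i : Fin n) (N : ℕ) (g : 𝓢(Eu n, ℂ)) :
    (List.replicate N i).foldr pdE g =
      ((fun f : 𝓢(Eu n, ℂ) => ∂_{(EuclideanSpace.single i (1 : ℝ) : Eu n)} f)^[N] g) := by
  induction N with
  | zero => rfl
  | succ N ih =>
    rw [List.replicate_succ, List.foldr_cons, ih, Function.iterate_succ_apply']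
    rfl

theorem fourier_iterate_lineDerivOp_single (i : Fin n) (N : ℕ) (g : 𝓢(Eu n, ℂ)) (t : Eu n) :
    𝓕 ((fun f : 𝓢(Eu n, ℂ) => ∂_{(EuclideanSpace.single i (1 : ℝ) : Eu n)} f)^[N] g) t =
      (2 * Real.pi * Complex.I * t i) ^ N * 𝓕 g t := by
  have hT : (fun x : Eu n => inner ℝ x (EuclideanSpace.single i (1 : ℝ))).HasTemperateGrowth := by
    fun_prop
  induction N with
  | zero => simp
  | succ N ih =>
    rw [Function.iterate_succ_apply', fourier_lineDerivOp_eq, smul_apply,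
      smulLeftCLM_apply_apply hT, ih, EuclideanSpace.inner_single_right]
    simp only [one_mul, conj_trivial, Complex.real_smul, smul_eq_mul]
    ring

theorem norm_fourier_le_integral_norm (g : 𝓢(Eu n, ℂ)) (t : Eu n) :
    ‖𝓕 g t‖ ≤ ∫ x, ‖g x‖ :=
  VectorFourier.norm_fourierIntegral_le_integral_norm _ _ _ _ _

/-- The sum of the `L¹` norms of all derivatives of `g` of order at most `N`. -/
def derivL1Sum (N : ℕ) (g : 𝓢(Eu n, ℂ)) : ℝ :=
  ∑ m ∈ Finset.Iic N, ∑ γ ∈ Finset.Nat.antidiagonalTuple n m, ∫ η : Eu n, ‖mderivE γ g η‖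

theorem integral_norm_mderivE_single_le {m N : ℕ} (hm : m ≤ N) (i : Fin n) (g : 𝓢(Eu n, ℂ)) :
    ∫ η : Eu n, ‖mderivE (Pi.single i m) g η‖ ≤ derivL1Sum N g := by
  have h0 : ∀ γ : Fin n → ℕ, 0 ≤ ∫ η : Eu n, ‖mderivE γ g η‖ := fun γ =>
    integral_nonneg fun _ => norm_nonneg _
  refine (Finset.single_le_sum (f := fun γ : Fin n → ℕ => ∫ η : Eu n, ‖mderivE γ g η‖)
    (fun γ _ => h0 γ)
    (Finset.Nat.mem_antidiagonalTuple.2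
      (by simp : ∑ j, (Pi.single i m : Fin n → ℕ) j = m))).trans ?_
  exact Finset.single_le_sum (f := fun m => ∑ γ ∈ Finset.Nat.antidiagonalTuple n m,
    ∫ η : Eu n, ‖mderivE γ g η‖) (fun m _ => Finset.sum_nonneg fun γ _ => h0 γ)
    (Finset.mem_Iic.2 hm)

theorem abs_pow_mul_norm_fourier_le {m N : ℕ} (hm : m ≤ N) (i : Fin n) (g : 𝓢(Eu n, ℂ))
    (t : Eu n) : |t i| ^ m * ‖𝓕 g t‖ ≤ derivL1Sum N g := by
  have h := norm_fourier_le_integral_norm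
    ((fun f : 𝓢(Eu n, ℂ) => ∂_{(EuclideanSpace.single i (1 : ℝ) : Eu n)} f)^[m] g) t
  rw [fourier_iterate_lineDerivOp_single, ← foldr_pdE_replicate, ← mIdx_single] at h
  refine le_trans ?_ (h.trans (integral_norm_mderivE_single_le hm i g))
  rw [norm_mul, norm_pow]
  gcongr
  simp only [norm_mul, Complex.norm_I, Complex.norm_real, Complex.norm_ofNat, mul_one,
    Real.norm_eq_abs, abs_of_pos Real.pi_pos]
  nlinarith [abs_nonneg (t i), Real.pi_gt_three]

theorem exists_norm_le_mul_abs (hn : 1 ≤ n) (t : Eu n) : ∃ i, ‖t‖ ≤ n * |t i| := by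
  have : Nonempty (Fin n) := ⟨⟨0, hn⟩⟩
  obtain ⟨i, hi⟩ := Finite.exists_max fun i => |t i|
  refine ⟨i, ?_⟩
  calc ‖t‖ ≤ ∑ j, |t j| := by
        rw [EuclideanSpace.norm_eq, Real.sqrt_le_left (Finset.sum_nonneg fun _ _ => abs_nonneg _)]
        exact Finset.sum_sq_le_sq_sum_of_nonneg fun _ _ => abs_nonneg _
    _ ≤ ∑ _j : Fin n, |t i| := Finset.sum_le_sum fun j _ => hi j
    _ = n * |t i| := by simp

theorem one_add_norm_pow_mul_norm_fourier_le (hn : 1 ≤ n) (N : ℕ) (g : 𝓢(Eu n, ℂ)) (t : Eu n) :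
    (1 + ‖t‖) ^ N * ‖𝓕 g t‖ ≤ 2 ^ (N - 1) * (1 + n ^ N) * derivL1Sum N g := by
  obtain ⟨i, hi⟩ := exists_norm_le_mul_abs hn t
  have h0 := abs_pow_mul_norm_fourier_le (Nat.zero_le N) i g t
  have hN := abs_pow_mul_norm_fourier_le (le_refl N) i g t
  rw [pow_zero, one_mul] at h0
  calc (1 + ‖t‖) ^ N * ‖𝓕 g t‖
      ≤ (2 ^ (N - 1) * (1 ^ N + (n * |t i|) ^ N)) * ‖𝓕 g t‖ := by
        gcongr
        refine (add_pow_le zero_le_one (norm_nonneg t) N).trans ?_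
        gcongr
    _ = 2 ^ (N - 1) * (‖𝓕 g t‖ + n ^ N * (|t i| ^ N * ‖𝓕 g t‖)) := by rw [mul_pow]; ring
    _ ≤ 2 ^ (N - 1) * (derivL1Sum N g + n ^ N * derivL1Sum N g) := by gcongr
    _ = _ := by ring

theorem integrable_pow_mul_norm_fourier (k : ℕ) (g : 𝓢(Eu n, ℂ)) :
    Integrable fun t : Eu n => ‖t‖ ^ k * ‖𝓕 g t‖ :=
  SchwartzMap.integrable_pow_mul volume (𝓕 g) k

theorem exists_integral_pow_mul_norm_fourier_le (hn : 1 ≤ n) {k N : ℕ} (h : k + n + 1 ≤ N) :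
    ∃ C, 0 ≤ C ∧ ∀ g : 𝓢(Eu n, ℂ), ∫ t, ‖t‖ ^ k * ‖𝓕 g t‖ ≤ C * derivL1Sum N g := by
  set B : ℝ := 2 ^ (N - 1) * (1 + n ^ N)
  have hB : 0 ≤ B := by positivity
  have hJ : Integrable fun t : Eu n => (1 + ‖t‖) ^ (-((n : ℝ) + 1)) :=
    integrable_one_add_norm (by simp)
  refine ⟨B * ∫ t : Eu n, (1 + ‖t‖) ^ (-((n : ℝ) + 1)),
    mul_nonneg hB (integral_nonneg fun t => by positivity), fun g => ?_⟩
  calc ∫ t, ‖t‖ ^ k * ‖𝓕 g t‖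
      ≤ ∫ t : Eu n, B * derivL1Sum N g * (1 + ‖t‖) ^ (-((n : ℝ) + 1)) := by
        refine integral_mono (integrable_pow_mul_norm_fourier k g) (hJ.const_mul _) fun t => ?_
        have ht : 1 ≤ 1 + ‖t‖ := by simp
        rw [Real.rpow_neg (by positivity), ← div_eq_mul_inv, le_div_iff₀ (by positivity)]
        norm_cast
        refine le_trans ?_ (one_add_norm_pow_mul_norm_fourier_le hn N g t)
        calc ‖t‖ ^ k * ‖𝓕 g t‖ * (1 + ‖t‖) ^ (n + 1)
            ≤ (1 + ‖t‖) ^ k * ‖𝓕 g t‖ * (1 + ‖t‖) ^ (n + 1) := by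
              gcongr
              linarith
          _ = (1 + ‖t‖) ^ (k + n + 1) * ‖𝓕 g t‖ := by ring
          _ ≤ (1 + ‖t‖) ^ N * ‖𝓕 g t‖ := by gcongr
    _ = _ := by rw [integral_const_mul]; ring

theorem integral_exp_mul_fourier (g : 𝓢(Eu n, ℂ)) (ξ : Eu n) :
    ∫ t, 𝓕 g t * Complex.exp (((2 * Real.pi * inner ℝ t ξ : ℝ) : ℂ) * Complex.I) = g ξ := by
  have h := congrArg (fun f : 𝓢(Eu n, ℂ) => f ξ) (FourierTransform.fourierInv_fourier_eq
    (F := 𝓢(Eu n, ℂ)) g)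
  simp only [fourierInv_coe, Real.fourierInv_eq', smul_eq_mul] at h
  simpa only [mul_comm] using h

end FourierDecay

section Pairing

variable {n : ℕ}

/-- The map `(t, z) ↦ 2π ∑ⱼ tⱼ zⱼ`. -/
def pairingCz (n : ℕ) : Eu n →L[ℝ] Cz n →L[ℝ] ℂ :=
  ∑ j, (EuclideanSpace.proj j : Eu n →L[ℝ] ℝ).smulRight
    ((2 * Real.pi) • (EuclideanSpace.proj j : Cz n →L[ℂ] ℂ).restrictScalars ℝ)

theorem pairingCz_apply (t : Eu n) (z : Cz n) :
    pairingCz n t z = ∑ j, 2 * Real.pi * t j * z j := by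
  simp only [pairingCz, sum_apply, ContinuousLinearMap.smulRight_apply,
    smul_apply, ContinuousLinearMap.coe_restrictScalars',
    PiLp.proj_apply, Complex.real_smul]
  refine Finset.sum_congr rfl fun j _ => ?_
  push_cast
  ring

/-- The map `(t, (ξ, z)) ↦ (2π ∑ⱼ tⱼ ξⱼ, 2π ∑ⱼ tⱼ (ξⱼ + zⱼ))`. -/
def pairingW (n : ℕ) : Eu n →L[ℝ] W n →L[ℝ] ℝ × ℂ :=
  ∑ j, (EuclideanSpace.proj j : Eu n →L[ℝ] ℝ).smulRight
    ((2 * Real.pi) • (((EuclideanSpace.proj j : Eu n →L[ℝ] ℝ).comp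
      (ContinuousLinearMap.fst ℝ (Eu n) (Cz n))).prod
        (Complex.ofRealCLM.comp ((EuclideanSpace.proj j : Eu n →L[ℝ] ℝ).comp
          (ContinuousLinearMap.fst ℝ (Eu n) (Cz n))) +
        ((EuclideanSpace.proj j : Cz n →L[ℂ] ℂ).restrictScalars ℝ).comp
          (ContinuousLinearMap.snd ℝ (Eu n) (Cz n)))))

theorem pairingW_apply_fst (t : Eu n) (w : W n) :
    (pairingW n t w).1 = 2 * Real.pi * inner ℝ t w.1 := by
  simp only [pairingW, sum_apply, ContinuousLinearMap.smulRight_apply,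
    smul_apply, Prod.fst_sum, Prod.smul_fst, ContinuousLinearMap.prod_apply,
    ContinuousLinearMap.comp_apply, ContinuousLinearMap.coe_fst', PiLp.proj_apply,
    smul_eq_mul, PiLp.inner_apply, Finset.mul_sum]
  refine Finset.sum_congr rfl fun j _ => ?_
  simp only [RCLike.inner_apply, conj_trivial]
  ring

theorem pairingW_apply_snd (t : Eu n) (w : W n) :
    (pairingW n t w).2 = ∑ j, 2 * Real.pi * t j * (w.1 j + w.2 j) := by
  simp only [pairingW, sum_apply, ContinuousLinearMap.smulRight_apply,
    smul_apply, Prod.snd_sum, Prod.smul_snd, ContinuousLinearMap.prod_apply,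
    ContinuousLinearMap.comp_apply, ContinuousLinearMap.coe_fst', ContinuousLinearMap.coe_snd',
    PiLp.proj_apply, add_apply, Complex.ofRealCLM_apply,
    ContinuousLinearMap.coe_restrictScalars', Complex.real_smul]
  refine Finset.sum_congr rfl fun j _ => ?_
  push_cast
  ring

theorem pairingW_snd_eq_add (t : Eu n) (w : W n) :
    (pairingW n t w).2 = (pairingW n t w).1 + pairingCz n t w.2 := by
  rw [pairingW_apply_fst, pairingW_apply_snd, pairingCz_apply, PiLp.inner_apply]
  push_cast
  rw [Finset.mul_sum, ← Finset.sum_add_distrib]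
  refine Finset.sum_congr rfl fun j _ => ?_
  simp only [RCLike.inner_apply, conj_trivial]
  push_cast
  ring

end Pairing

section Division

open Filter FourierTransform SchwartzMap

variable {n : ℕ}

theorem integrable_superposition {E V : Type*} [NormedAddCommGroup E] [NormedSpace ℝ E]
    [NormedAddCommGroup V] [NormedSpace ℝ V] {Φ : V → ℂ} {a : Eu n → ℂ}
    (hΦ : ContDiff ℝ (⊤ : ℕ∞) Φ) (hb : ∀ N, BddDerivOn N Φ Set.univ) (ha : Continuous a)
    (hi : ∀ k : ℕ, Integrable fun t => ‖t‖ ^ k * ‖a t‖) (Λ : Eu n →L[ℝ] E →L[ℝ] V) (w : E) :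
    Integrable fun t => a t * Φ (Λ t w) := by
  obtain ⟨C, hC⟩ := (hb 0).2 0 le_rfl
  simp only [iteratedFDerivWithin_univ, Set.mem_univ, forall_const, norm_iteratedFDeriv_zero] at hC
  refine ((hi 0).const_mul C).mono' (ha.mul (hΦ.continuous.comp (by fun_prop))).aestronglyMeasurable
    (Eventually.of_forall fun t => ?_)
  rw [norm_mul, pow_zero, one_mul, mul_comm]
  gcongr
  exact hC _

theorem isLinearMap_superposition {V : Type*} [NormedAddCommGroup V] [NormedSpace ℝ V] {Φ : V → ℂ}
    (hΦ : ContDiff ℝ (⊤ : ℕ∞) Φ) (hb : ∀ N, BddDerivOn N Φ Set.univ) {c : Eu n → ℂ}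
    (hc : Continuous c)
    (hi : ∀ (g : 𝓢(Eu n, ℂ)) (k : ℕ), Integrable fun t => ‖t‖ ^ k * ‖𝓕 g t * c t‖)
    (L : Eu n →L[ℝ] V) :
    IsLinearMap ℂ fun g : 𝓢(Eu n, ℂ) => ∫ t, 𝓕 g t * c t * Φ (L t) := by
  have hI : ∀ g : 𝓢(Eu n, ℂ), Integrable fun t => 𝓕 g t * c t * Φ (L t) := fun g =>
    integrable_superposition hΦ hb ((𝓕 g).continuous.mul hc) (hi g)
      ((ContinuousLinearMap.smulRightL ℝ ℝ V (ContinuousLinearMap.id ℝ ℝ)).comp L) (1 : ℝ) |>.congr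
        (Eventually.of_forall fun t => by simp)
  refine ⟨fun g h => ?_, fun z g => ?_⟩
  · rw [← integral_add (hI g) (hI h)]
    refine integral_congr_ae (Eventually.of_forall fun t => ?_)
    simp only [FourierTransform.fourier_add, add_apply, add_mul]
  · rw [smul_eq_mul, ← integral_const_mul]
    refine integral_congr_ae (Eventually.of_forall fun t => ?_)
    simp only [FourierTransform.fourier_smul, smul_apply, smul_eq_mul, mul_assoc]

theorem pow_mul_norm_fourier_mul_coord_le (j : Fin n) (g : 𝓢(Eu n, ℂ)) (k : ℕ) (t : Eu n) :
    ‖t‖ ^ k * ‖𝓕 g t * (2 * Real.pi * t j)‖ ≤ 2 * Real.pi * (‖t‖ ^ (k + 1) * ‖𝓕 g t‖) := by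
  have h : ‖(2 * Real.pi * t j : ℂ)‖ ≤ 2 * Real.pi * ‖t‖ := by
    simp only [norm_mul, Complex.norm_real, Complex.norm_ofNat, Real.norm_of_nonneg Real.pi_pos.le]
    gcongr
    exact PiLp.norm_apply_le t j
  calc ‖t‖ ^ k * ‖𝓕 g t * (2 * Real.pi * t j)‖
      ≤ ‖t‖ ^ k * (‖𝓕 g t‖ * (2 * Real.pi * ‖t‖)) := by rw [norm_mul]; gcongr
    _ = _ := by ring

theorem continuous_fourier_mul_coord (j : Fin n) (g : 𝓢(Eu n, ℂ)) :
    Continuous fun t : Eu n => 𝓕 g t * (2 * Real.pi * t j) :=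
  (𝓕 g).continuous.mul (by fun_prop)

theorem integrable_pow_mul_norm_fourier_mul_coord (j : Fin n) (g : 𝓢(Eu n, ℂ)) (k : ℕ) :
    Integrable fun t : Eu n => ‖t‖ ^ k * ‖𝓕 g t * (2 * Real.pi * t j)‖ := by
  refine ((integrable_pow_mul_norm_fourier (k + 1) g).const_mul (2 * Real.pi)).mono'
    (by have := continuous_fourier_mul_coord j g; fun_prop) (Eventually.of_forall fun t => ?_)
  rw [Real.norm_of_nonneg (by positivity)]
  exact pow_mul_norm_fourier_mul_coord_le j g k t

theorem exists_integral_pow_mul_norm_fourier_mul_coord_le (hn : 1 ≤ n) {k N : ℕ}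
    (h : k + n + 2 ≤ N) : ∃ C, 0 ≤ C ∧ ∀ (j : Fin n) (g : 𝓢(Eu n, ℂ)),
      ∫ t : Eu n, ‖t‖ ^ k * ‖𝓕 g t * (2 * Real.pi * t j)‖ ≤ C * derivL1Sum N g := by
  obtain ⟨C, hC0, hC⟩ := exists_integral_pow_mul_norm_fourier_le hn (k := k + 1) (N := N) (by lia)
  refine ⟨2 * Real.pi * C, by positivity, fun j g => ?_⟩
  calc ∫ t : Eu n, ‖t‖ ^ k * ‖𝓕 g t * (2 * Real.pi * t j)‖
      ≤ ∫ t : Eu n, 2 * Real.pi * (‖t‖ ^ (k + 1) * ‖𝓕 g t‖) :=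
        integral_mono (integrable_pow_mul_norm_fourier_mul_coord j g k)
          ((integrable_pow_mul_norm_fourier (k + 1) g).const_mul _)
          (pow_mul_norm_fourier_mul_coord_le j g k)
    _ ≤ 2 * Real.pi * (C * derivL1Sum N g) := by
        rw [integral_const_mul]
        gcongr
        exact hC g
    _ = _ := by ring

/-- The function `(s, ζ) ↦ e^{is} H(ζ)`. -/
def modulated (H : ℂ → ℂ) (p : ℝ × ℂ) : ℂ :=
  Complex.exp (p.1 * Complex.I) * H p.2

theorem contDiff_modulated {H : ℂ → ℂ} (hH : ContDiff ℝ (⊤ : ℕ∞) H) :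
    ContDiff ℝ (⊤ : ℕ∞) (modulated H) :=
  (contDiff_cexp_mul_I.comp contDiff_fst).mul (hH.comp contDiff_snd)

theorem bddDerivOn_modulated {H : ℂ → ℂ} (hH : ∀ N, BddDerivOn N H Set.univ) (N : ℕ) :
    BddDerivOn N (modulated H) Set.univ :=
  ((bddDerivOn_cexp_mul_I N).comp_clm (ContinuousLinearMap.fst ℝ ℝ ℂ)).mul
    ((hH N).comp_clm (ContinuousLinearMap.snd ℝ ℝ ℂ)) isOpen_univ

theorem division_integrand_identity {R H : ℂ → ℂ} (h1 : ∀ ζ, ζ * H ζ = 1 - R ζ)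
    (h2 : ∀ (s : ℝ) (ω : ℂ), Complex.exp (s * Complex.I) * R (s + ω) = R ω) (t : Eu n) (w : W n) :
    Complex.exp (((2 * Real.pi * inner ℝ t w.1 : ℝ) : ℂ) * Complex.I) =
      (∑ j, 2 * Real.pi * t j * modulated H (pairingW n t w) * (w.1 j + w.2 j)) +
        R (pairingCz n t w.2) := by
  have hs : (∑ j, 2 * Real.pi * t j * modulated H (pairingW n t w) * (w.1 j + w.2 j)) =
      (pairingW n t w).2 * modulated H (pairingW n t w) := by
    rw [pairingW_apply_snd, Finset.sum_mul]
    exact Finset.sum_congr rfl fun j _ => by ring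
  rw [hs, modulated, ← h2 (pairingW n t w).1, ← pairingW_snd_eq_add, pairingW_apply_fst]
  linear_combination (-Complex.exp (((2 * Real.pi * inner ℝ t w.1 : ℝ) : ℂ) * Complex.I)) *
    h1 (pairingW n t w).2

theorem norm_dirXi (i : Fin n) : ‖(dirXi i : W n)‖ = 1 := by simp [dirXi, Prod.norm_def]

theorem norm_dirRe (i : Fin n) : ‖(dirRe i : W n)‖ = 1 := by simp [dirRe, Prod.norm_def]

theorem norm_dirIm (i : Fin n) : ‖(dirIm i : W n)‖ = 1 := by simp [dirIm, Prod.norm_def]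

end Division

/-- **Lemma IV.2.1 (division lemma).** There are maps `q_j(ξ,z,g)` and `r(z,g)`,
linear in `g ∈ 𝒮(ℝⁿ)` and `C^∞` in `(ξ,z) ∈ ℝⁿ × ℂⁿ`, with
`g(ξ) = Σ_j q_j(ξ,z,g)(ξ_j + z_j) + r(z,g)` and the derivative bounds
`|∂_ξ^α ∂_z^β q_j| ≤ C_{αβ} Σ_{|γ| ≤ |α|+|β|+4n} ∫ |∂^γ g|`,
`|∂_z^β r| ≤ C_β Σ_{|γ| ≤ |β|+3n} ∫ |∂^γ g|`. -/
theorem statement9 (n : ℕ) (hn : 1 ≤ n) :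
    ∃ (q : Fin n → W n → SchwartzMap (Eu n) ℂ → ℂ)
      (r : Cz n → SchwartzMap (Eu n) ℂ → ℂ),
      (∀ (j : Fin n) (w : W n), IsLinearMap ℂ (q j w)) ∧
      (∀ z : Cz n, IsLinearMap ℂ (r z)) ∧
      (∀ (j : Fin n) (g : SchwartzMap (Eu n) ℂ),
        ContDiff ℝ (⊤ : ℕ∞) (fun w : W n => q j w g)) ∧
      (∀ g : SchwartzMap (Eu n) ℂ, ContDiff ℝ (⊤ : ℕ∞) (fun z : Cz n => r z g)) ∧
      (∀ (g : SchwartzMap (Eu n) ℂ) (ξ : Eu n) (z : Cz n),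
        g ξ = (∑ j, q j (ξ, z) g * ((ξ j : ℂ) + z j)) + r z g) ∧
      (∀ a bd : ℕ, ∃ C : ℝ, ∀ lξ lz : List (W n),
        lξ.length = a → lz.length = bd →
        (∀ v ∈ lξ, ∃ i, v = dirXi i) →
        (∀ v ∈ lz, ∃ i, v = dirRe i ∨ v = dirIm i) →
        ∀ (j : Fin n) (g : SchwartzMap (Eu n) ℂ) (w : W n),
          ‖wdList (lξ ++ lz) (fun w' => q j w' g) w‖ ≤
            C * ∑ m ∈ Finset.Iic (a + bd + 4 * n),
              ∑ γ ∈ Finset.Nat.antidiagonalTuple n m,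
                ∫ η : Eu n, ‖mderivE γ (⇑g) η‖) ∧
      (∀ bd : ℕ, ∃ C : ℝ, ∀ lz : List (Cz n),
        lz.length = bd →
        (∀ v ∈ lz, ∃ i, v = EuclideanSpace.single i (1 : ℂ) ∨
          v = EuclideanSpace.single i Complex.I) →
        ∀ (g : SchwartzMap (Eu n) ℂ) (z : Cz n),
          ‖cdList lz (fun z' => r z' g) z‖ ≤
            C * ∑ m ∈ Finset.Iic (bd + 3 * n),
              ∑ γ ∈ Finset.Nat.antidiagonalTuple n m,
                ∫ η : Eu n, ‖mderivE γ (⇑g) η‖) := by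
  obtain ⟨R, H, hR, hH, hRb, hHb, hdiv, hshift⟩ := exists_division_kernel
  have hΦ := contDiff_modulated hH
  have hΦb := bddDerivOn_modulated hHb
  have hrI := fun (g : SchwartzMap (Eu n) ℂ) k => integrable_pow_mul_norm_fourier k g
  have hqI := integrable_pow_mul_norm_fourier_mul_coord (n := n)
  have hqc := continuous_fourier_mul_coord (n := n)
  have hrs := fun g : SchwartzMap (Eu n) ℂ =>
    contDiff_superposition (Λ := pairingCz n) hR hRb (FourierTransform.fourier g).continuous (hrI g)
  have hqs := fun j g =>
    contDiff_superposition (Λ := pairingW n) hΦ hΦb (hqc j g) (hqI j g)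
  refine ⟨fun j w g => ∫ t : Eu n, FourierTransform.fourier g t * (2 * Real.pi * t j) *
      modulated H (pairingW n t w),
    fun z g => ∫ t : Eu n, FourierTransform.fourier g t * R (pairingCz n t z),
    fun j w => ?_, fun z => ?_, hqs, hrs, fun g ξ z => ?_, fun a bd => ?_, fun bd => ?_⟩
  · exact isLinearMap_superposition hΦ hΦb (by fun_prop) (hqI j) ((pairingW n).flip w)
  · simpa using isLinearMap_superposition hR hRb (continuous_const (y := 1))
      (by simpa using hrI) ((pairingCz n).flip z)
  · have hq := fun j => (integrable_superposition hΦ hΦb (hqc j g) (hqI j g) (pairingW n)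
      (ξ, z)).mul_const ((ξ j : ℂ) + z j)
    have hr := integrable_superposition hR hRb (FourierTransform.fourier g).continuous (hrI g)
      (pairingCz n) z
    simp only [← integral_mul_const]
    rw [← integral_finsetSum _ fun j _ => hq j, ← integral_add (integrable_finsetSum _ fun j _ =>
      hq j) hr, ← integral_exp_mul_fourier g ξ]
    refine integral_congr_ae (Filter.Eventually.of_forall fun t => ?_)
    change _ * Complex.exp (((2 * Real.pi * inner ℝ t (ξ, z).1 : ℝ) : ℂ) * Complex.I) = _
    rw [division_integrand_identity hdiv hshift t (ξ, z), mul_add, Finset.mul_sum]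
    simp only [mul_assoc]
  · obtain ⟨C, hC0, hC⟩ := exists_norm_iteratedFDeriv_superposition_le hΦ hΦb (pairingW n) (a + bd)
    obtain ⟨C', -, hC'⟩ := exists_integral_pow_mul_norm_fourier_mul_coord_le hn
      (k := a + bd) (N := a + bd + 4 * n) (by lia)
    refine ⟨C * C', fun lξ lz hξ hz hlξ hlz j g w => ?_⟩
    have hl : ∀ v ∈ lξ ++ lz, ‖v‖ ≤ 1 := fun v hv => by
      rcases List.mem_append.1 hv with hv | hv
      · obtain ⟨i, rfl⟩ := hlξ v hv
        exact (norm_dirXi i).le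
      · obtain ⟨i, rfl | rfl⟩ := hlz v hv
        · exact (norm_dirRe i).le
        · exact (norm_dirIm i).le
    refine (norm_foldr_fderiv_le (hqs j g) (lξ ++ lz) hl w).trans ?_
    rw [List.length_append, hξ, hz, mul_assoc]
    exact (hC _ (hqc j g) (hqI j g) w).trans (mul_le_mul_of_nonneg_left (hC' j g) hC0)
  · obtain ⟨C, hC0, hC⟩ := exists_norm_iteratedFDeriv_superposition_le hR hRb (pairingCz n) bd
    obtain ⟨C', -, hC'⟩ := exists_integral_pow_mul_norm_fourier_le hn
      (k := bd) (N := bd + 3 * n) (by lia)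
    refine ⟨C * C', fun lz hz hlz g z => ?_⟩
    have hl : ∀ v ∈ lz, ‖v‖ ≤ 1 := fun v hv => by
      obtain ⟨i, rfl | rfl⟩ := hlz v hv <;> simp
    refine (norm_foldr_fderiv_le (hrs g) lz hl z).trans ?_
    rw [hz, mul_assoc]
    exact (hC _ (FourierTransform.fourier g).continuous (hrI g) z).trans
      (mul_le_mul_of_nonneg_left (hC' g) hC0)

end Paper
end
end

section
/- Let n ≥ 1 and let a, b ∈ ℝⁿ satisfy |a − b| ≤ ⟨a⟩. Then for all s ∈ [0,1]: (1−s)|a| + s|b| ≤ √2 ⟨(1−s)a + sb⟩. -/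
/-- **Lemma IV.4.16.** If `a, b ∈ ℝⁿ` satisfy `‖a − b‖ ≤ ⟨a⟩`, then for all `s ∈ [0,1]`,
`(1−s)‖a‖ + s‖b‖ ≤ √2 ⟨(1−s)a + sb⟩`, where `⟨x⟩ = (1 + ‖x‖²)^{1/2}`. -/
theorem statement10 (n : ℕ) (hn : 1 ≤ n)
    (a b : EuclideanSpace ℝ (Fin n))
    (h : ‖a - b‖ ≤ Real.sqrt (1 + ‖a‖ ^ 2)) :
    ∀ s ∈ Set.Icc (0 : ℝ) 1,
      (1 - s) * ‖a‖ + s * ‖b‖ ≤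
        Real.sqrt 2 * Real.sqrt (1 + ‖(1 - s) • a + s • b‖ ^ 2) := by
  rintro s ⟨hs0, hs1⟩
  have hsq : ‖a - b‖ ^ 2 ≤ 1 + ‖a‖ ^ 2 :=
    (Real.le_sqrt (norm_nonneg _) (by positivity)).1 h
  rw [norm_sub_sq_real] at hsq
  have hcomb : ‖(1 - s) • a + s • b‖ ^ 2 =
      (1 - s) ^ 2 * ‖a‖ ^ 2 + 2 * (s * (1 - s)) * inner ℝ a b + s ^ 2 * ‖b‖ ^ 2 := by
    rw [norm_add_sq_real, norm_smul, norm_smul, real_inner_smul_left, real_inner_smul_right,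
      mul_pow, mul_pow, Real.norm_eq_abs, Real.norm_eq_abs, sq_abs, sq_abs]
    ring
  rw [← Real.sqrt_mul zero_le_two]
  apply Real.le_sqrt_of_sq_le
  rw [hcomb]
  have hst : 0 ≤ s * (1 - s) := mul_nonneg hs0 (sub_nonneg.2 hs1)
  have hinner : 0 ≤ s * (1 - s) * (1 + 2 * inner ℝ a b - ‖b‖ ^ 2) :=
    mul_nonneg hst (by linarith)
  have hb : 0 ≤ s * (1 - s) * ‖b‖ ^ 2 := mul_nonneg hst (sq_nonneg _)
  linarith [sq_nonneg ((1 - s) * ‖a‖ - s * ‖b‖), sq_nonneg s, sq_nonneg (1 - s)]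
end
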